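/- arXiv:2604.11371 — 9 statements merged into one kernel-verified Lean document; each statement's English description precedes it below -/
import Mathlib

section
/- Let Ω ⊆ ℝ³ be a nonempty open bounded convex set, let x ∈ Ω, and set δ = dist(x, ∂Ω) > 0. Then ∫_{{w ∈ Ω : ‖x − w‖ > 2δ}} ‖x − w‖^{−4} dw ≤ 3π/(2δ), where the integral is taken with respect to Lebesgue measure on ℝ³. -/
open MeasureTheory Set

/-- Integration of a radial function over the plane, in terms of the squared radius. -/
theorem lintegral_prod_sq_add_sq {G : ℝ → ENNReal} (hG : Measurable G) :
    ∫⁻ p : ℝ × ℝ, G (p.1 ^ 2 + p.2 ^ 2) = ENNReal.ofReal Real.pi * ∫⁻ s in Ioi 0, G s := by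
  have himage : (fun r : ℝ => r ^ 2) '' Ioi 0 = Ioi 0 := by
    ext s
    simp only [mem_image, mem_Ioi]
    exact ⟨fun ⟨r, hr, h⟩ => h ▸ by positivity,
      fun hs => ⟨√s, Real.sqrt_pos.2 hs, Real.sq_sqrt hs.le⟩⟩
  have hsub : ∫⁻ s in Ioi 0, G s = 2 * ∫⁻ r in Ioi (0 : ℝ), ENNReal.ofReal r * G (r ^ 2) := by
    rw [← lintegral_const_mul _ (by fun_prop)]
    conv_lhs => rw [← himage]
    rw [lintegral_image_eq_lintegral_abs_deriv_mul (f' := fun r => 2 * r) measurableSet_Ioi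
      (fun r _ => by simpa using (hasDerivAt_pow 2 r).hasDerivWithinAt)
      (fun a ha b hb h => (sq_eq_sq₀ (le_of_lt ha) (le_of_lt hb)).1 h)]
    refine setLIntegral_congr_fun measurableSet_Ioi fun r hr => ?_
    have hr : 0 < r := hr
    rw [abs_of_pos (by positivity), ENNReal.ofReal_mul (by norm_num), mul_assoc]
    simp
  rw [← lintegral_comp_polarCoord_symm]
  have hpolar : ∀ p : ℝ × ℝ, (polarCoord.symm p).1 ^ 2 + (polarCoord.symm p).2 ^ 2 = p.1 ^ 2 := by
    intro p
    simp only [polarCoord_symm_apply]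
    linear_combination p.1 ^ 2 * Real.sin_sq_add_cos_sq p.2
  simp only [hpolar, smul_eq_mul, polarCoord_target]
  rw [Measure.volume_eq_prod, ← Measure.prod_restrict, lintegral_prod _ (by fun_prop), hsub]
  simp only [lintegral_const, MeasurableSet.univ, Measure.restrict_apply, univ_inter,
    Real.volume_Ioo]
  rw [lintegral_mul_const _ (by fun_prop), sub_neg_eq_add, ← two_mul,
    ENNReal.ofReal_mul (by norm_num)]
  simp only [ENNReal.ofReal_ofNat]
  ring

/-- Slicing of three-dimensional space by planes orthogonal to a unit vector, for functions that
depend only on the height and on the norm. -/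
theorem lintegral_inner_norm_sq {F : ℝ × ℝ → ENNReal} (hF : Measurable F)
    {ν : EuclideanSpace ℝ (Fin 3)} (hν : ‖ν‖ = 1) :
    ∫⁻ w, F (inner ℝ ν w, ‖w‖ ^ 2) =
      ∫⁻ t : ℝ, ENNReal.ofReal Real.pi * ∫⁻ s in Ioi 0, F (t, t ^ 2 + s) := by
  obtain ⟨b, hb⟩ := Orthonormal.exists_orthonormalBasis_extension_of_card_eq (𝕜 := ℝ)
    (ι := Fin 3) (by simp) (v := fun _ => ν) (s := {0})
    ⟨fun _ => hν, fun i j hij => (hij (Subsingleton.elim i j)).elim⟩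
  have hb0 : b 0 = ν := hb 0 rfl
  let H : EuclideanSpace ℝ (Fin 3) → ENNReal := fun v =>
    F (v 0, v 0 ^ 2 + (v 1 ^ 2 + v 2 ^ 2))
  have hcoord : ∀ w, F (inner ℝ ν w, ‖w‖ ^ 2) = H (b.repr w) := by
    intro w
    rw [← b.repr.norm_map w, EuclideanSpace.norm_sq_eq, Fin.sum_univ_three]
    simp [H, b.repr_apply_apply, hb0, add_assoc]
  rw [lintegral_congr hcoord,
    b.measurePreserving_repr.lintegral_comp_emb b.repr.toHomeomorph.measurableEmbedding H,
    ← (PiLp.volume_preserving_toLp (Fin 3)).lintegral_comp_emb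
      (MeasurableEquiv.toLp 2 (Fin 3 → ℝ)).measurableEmbedding,
    ← (volume_preserving_piFinSuccAbove (fun _ : Fin 3 => ℝ) 0).symm.lintegral_comp_emb
      (MeasurableEquiv.measurableEmbedding _), Measure.volume_eq_prod, lintegral_prod _ (by
        refine Measurable.aemeasurable ?_
        fun_prop)]
  refine lintegral_congr fun t => ?_
  rw [← lintegral_prod_sq_add_sq (G := fun s => F (t, t ^ 2 + s)) (by fun_prop),
    ← (volume_preserving_finTwoArrow ℝ).lintegral_comp_emb
      (MeasurableEquiv.measurableEmbedding _)]
  rfl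

theorem lintegral_Ioi_inv_sq {c : ℝ} (hc : 0 < c) :
    ∫⁻ q in Ioi c, ENNReal.ofReal (q ^ 2)⁻¹ = ENNReal.ofReal c⁻¹ := by
  have hrpow : ∀ q ∈ Ioi c, ENNReal.ofReal (q ^ 2)⁻¹ = ENNReal.ofReal (q ^ (-2 : ℝ)) := by
    intro q hq
    rw [Real.rpow_neg (hc.trans hq).le]
    norm_num
  rw [setLIntegral_congr_fun measurableSet_Ioi hrpow, ← ofReal_integral_eq_lintegral_ofReal
    (integrableOn_Ioi_rpow_of_lt (by norm_num) hc), integral_Ioi_rpow_of_lt (by norm_num) hc]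
  · norm_num [Real.rpow_neg_one]
  · filter_upwards [ae_restrict_mem measurableSet_Ioi] with q hq
    exact Real.rpow_nonneg (hc.trans hq).le _

theorem measurableSet_inner_le_and_lt_norm (ν : EuclideanSpace ℝ (Fin 3)) (a r : ℝ) :
    MeasurableSet {w : EuclideanSpace ℝ (Fin 3) | inner ℝ ν w ≤ a ∧ r < ‖w‖} :=
  have hinner : Measurable fun w : EuclideanSpace ℝ (Fin 3) => inner ℝ ν w := by fun_prop
  (measurableSet_le hinner measurable_const).inter
    (measurableSet_lt measurable_const measurable_norm)

/-- The integral of `‖w‖⁻⁴` over a half-space at height `δ`, outside the ball of radius `2δ`. -/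
theorem lintegral_halfSpace_inv_norm_pow_four_le {δ : ℝ} (hδ : 0 < δ)
    {ν : EuclideanSpace ℝ (Fin 3)} (hν : ‖ν‖ = 1) :
    ∫⁻ w in {w | inner ℝ ν w ≤ δ ∧ 2 * δ < ‖w‖}, ENNReal.ofReal (‖w‖ ^ 4)⁻¹ ≤
      ENNReal.ofReal (5 * Real.pi / (4 * δ)) := by
  let S : Set (ℝ × ℝ) := {p | p.1 ≤ δ ∧ (2 * δ) ^ 2 < p.2}
  have hS : MeasurableSet S :=
    (measurableSet_le measurable_fst measurable_const).inter
      (measurableSet_lt measurable_const measurable_snd)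
  let F : ℝ × ℝ → ENNReal := S.indicator fun p => ENNReal.ofReal (p.2 ^ 2)⁻¹
  have hF : Measurable F := Measurable.indicator (by fun_prop) hS
  have hmeas : MeasurableSet {w : EuclideanSpace ℝ (Fin 3) | inner ℝ ν w ≤ δ ∧ 2 * δ < ‖w‖} :=
    measurableSet_inner_le_and_lt_norm ν δ (2 * δ)
  have hslice : ∀ t, ∫⁻ s in Ioi 0, F (t, t ^ 2 + s) ≤
      (Iic δ).indicator (fun t => ENNReal.ofReal (max ((2 * δ) ^ 2) (t ^ 2))⁻¹) t := by
    intro t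
    by_cases ht : t ≤ δ
    · rw [indicator_of_mem (mem_Iic.2 ht), ← lintegral_Ioi_inv_sq (by positivity),
        ← lintegral_indicator measurableSet_Ioi, ← lintegral_indicator measurableSet_Ioi,
        ← lintegral_add_left_eq_self (indicator (Ioi (max _ _)) _) (t ^ 2)]
      refine lintegral_mono fun s => ?_
      simp only [indicator_apply, F, S, mem_Ioi, mem_ofPred_eq, ht, true_and, max_lt_iff,
        lt_add_iff_pos_right]
      split_ifs <;> simp_all
    · rw [indicator_of_notMem (by simpa using ht)]
      simp [F, S, ht]
  have hfar : ∫⁻ t in Iic (-(2 * δ)), ENNReal.ofReal (max ((2 * δ) ^ 2) (t ^ 2))⁻¹ ≤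
      ENNReal.ofReal (2 * δ)⁻¹ := by
    rw [← lintegral_Ioi_inv_sq (by positivity : 0 < 2 * δ), ← setLIntegral_congr Iio_ae_eq_Iic,
      ← lintegral_indicator measurableSet_Ioi, ← lintegral_indicator measurableSet_Iio,
      ← lintegral_neg_eq_self]
    refine lintegral_mono fun t => ?_
    simp only [indicator_apply, mem_Iio, mem_Ioi, neg_lt_neg_iff, neg_sq]
    split_ifs with ht
    · have ht' : 0 < t ^ 2 := pow_pos (lt_trans (by positivity) ht) 2
      gcongr
      exact le_max_right _ _
    · simp
  have hnear : ∫⁻ t in Ioc (-(2 * δ)) δ, ENNReal.ofReal (max ((2 * δ) ^ 2) (t ^ 2))⁻¹ ≤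
      ENNReal.ofReal (3 / (4 * δ)) := by
    calc _ ≤ ∫⁻ t in Ioc (-(2 * δ)) δ, ENNReal.ofReal ((2 * δ) ^ 2)⁻¹ := by
          gcongr with t
          exact le_max_left _ _
      _ = ENNReal.ofReal (3 / (4 * δ)) := by
          rw [setLIntegral_const, Real.volume_Ioc, ← ENNReal.ofReal_mul (by positivity)]
          congr 1
          field_simp
          ring
  calc _ = ∫⁻ w, F (inner ℝ ν w, ‖w‖ ^ 2) := by
        rw [← lintegral_indicator hmeas]
        refine lintegral_congr fun w => ?_
        simp only [indicator_apply, F, S, mem_ofPred_eq,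
          sq_lt_sq₀ (by positivity : 0 ≤ 2 * δ) (norm_nonneg w), ← pow_mul]
    _ = ∫⁻ t : ℝ, ENNReal.ofReal Real.pi * ∫⁻ s in Ioi 0, F (t, t ^ 2 + s) :=
        lintegral_inner_norm_sq hF hν
    _ ≤ ENNReal.ofReal Real.pi *
          ∫⁻ t in Iic δ, ENNReal.ofReal (max ((2 * δ) ^ 2) (t ^ 2))⁻¹ := by
        rw [← lintegral_indicator measurableSet_Iic, ← lintegral_const_mul' _ _ (by simp)]
        exact lintegral_mono fun t => mul_le_mul_right (hslice t) _
    _ ≤ ENNReal.ofReal Real.pi *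
          (ENNReal.ofReal (2 * δ)⁻¹ + ENNReal.ofReal (3 / (4 * δ))) := by
        gcongr
        rw [← Iic_union_Ioc_eq_Iic (by linarith : -(2 * δ) ≤ δ)]
        exact (lintegral_union_le _ _ _).trans (add_le_add hfar hnear)
    _ = ENNReal.ofReal (5 * Real.pi / (4 * δ)) := by
        rw [← ENNReal.ofReal_add (by positivity) (by positivity),
          ← ENNReal.ofReal_mul Real.pi_pos.le]
        congr 1
        field_simp
        ring

/-- An open convex set lies on one side of some hyperplane through any point outside of it; the
distance from an inner point `x` to that hyperplane is at most the distance to the point. -/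
theorem Convex.exists_unit_inner_sub_le_dist {E : Type*} [NormedAddCommGroup E]
    [InnerProductSpace ℝ E] [CompleteSpace E] {s : Set E} (hs : Convex ℝ s) (ho : IsOpen s)
    {x z : E} (hx : x ∈ s) (hz : z ∉ s) :
    ∃ ν : E, ‖ν‖ = 1 ∧ ∀ w ∈ s, inner ℝ ν (w - x) ≤ dist x z := by
  obtain ⟨f, hf⟩ := geometric_hahn_banach_open_point hs ho hz
  obtain ⟨u, rfl⟩ := (InnerProductSpace.toDual ℝ E).surjective f
  simp only [InnerProductSpace.toDual_apply_apply] at hf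
  have hu : u ≠ 0 := by
    rintro rfl
    simpa using hf x hx
  have hu' : 0 < ‖u‖ := norm_pos_iff.2 hu
  refine ⟨‖u‖⁻¹ • u, by simp [norm_smul, hu'.ne'], fun w hw => ?_⟩
  rw [real_inner_smul_left, inv_mul_le_iff₀ hu', dist_comm, dist_eq_norm]
  refine le_trans ?_ (real_inner_le_norm u (z - x))
  rw [inner_sub_right, inner_sub_right]
  linarith [hf w hw]

/-- **Interior volume-integral estimate in a bounded convex domain of `ℝ³`.**
If `Ω ⊆ ℝ³` is a nonempty open bounded convex set and `x ∈ Ω`, then with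
`δ = dist(x, ∂Ω)` one has `δ > 0` and
`∫_{w ∈ Ω, ‖x − w‖ > 2δ} ‖x − w‖⁻⁴ dw ≤ 3π/(2δ)`. -/
theorem stmt1 (Ω : Set (EuclideanSpace ℝ (Fin 3)))
    (hopen : IsOpen Ω) (hbd : Bornology.IsBounded Ω) (hconv : Convex ℝ Ω) (hne : Ω.Nonempty)
    (x : EuclideanSpace ℝ (Fin 3)) (hx : x ∈ Ω) :
    0 < Metric.infDist x (frontier Ω) ∧
    ∫ w in {w | w ∈ Ω ∧ 2 * Metric.infDist x (frontier Ω) < ‖x - w‖}, (‖x - w‖ ^ 4)⁻¹ ≤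
      3 * Real.pi / (2 * Metric.infDist x (frontier Ω)) := by
  have huniv : Ω ≠ univ := by
    rintro rfl
    exact NormedSpace.unbounded_univ ℝ _ hbd
  have hfr : (frontier Ω).Nonempty := nonempty_frontier_iff.2 ⟨hne, huniv⟩
  have hdisj : ∀ z ∈ frontier Ω, z ∉ Ω := fun z hz => by
    rw [hopen.frontier_eq] at hz
    exact hz.2
  have hδ : 0 < Metric.infDist x (frontier Ω) :=
    (isClosed_frontier.notMem_iff_infDist_pos hfr).1 fun h => hdisj x h hx
  refine ⟨hδ, ?_⟩
  obtain ⟨z, hz, hzx⟩ := isClosed_frontier.exists_infDist_eq_dist hfr x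
  obtain ⟨ν, hν, hΩ⟩ := hconv.exists_unit_inner_sub_le_dist hopen hx (hdisj z hz)
  rw [← hzx] at hΩ
  generalize Metric.infDist x (frontier Ω) = δ at hδ hΩ
  have hmeasΩ : MeasurableSet {w | w ∈ Ω ∧ 2 * δ < ‖x - w‖} :=
    hopen.measurableSet.inter
      (measurableSet_lt measurable_const (measurable_id.const_sub x).norm)
  have hmeas : MeasurableSet {w : EuclideanSpace ℝ (Fin 3) | inner ℝ ν w ≤ δ ∧ 2 * δ < ‖w‖} :=
    measurableSet_inner_le_and_lt_norm ν δ (2 * δ)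
  rw [integral_eq_lintegral_of_nonneg_ae (ae_of_all _ fun w => by positivity)
    (by fun_prop : Measurable fun w => (‖x - w‖ ^ 4)⁻¹).aestronglyMeasurable]
  refine ENNReal.toReal_le_of_le_ofReal (by positivity) ?_
  calc _ ≤ ∫⁻ w in {w | inner ℝ ν w ≤ δ ∧ 2 * δ < ‖w‖}, ENNReal.ofReal (‖w‖ ^ 4)⁻¹ := by
        rw [← lintegral_indicator hmeasΩ, ← lintegral_indicator hmeas,
          ← lintegral_sub_right_eq_self (indicator {w | inner ℝ ν w ≤ δ ∧ _} _) x]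
        refine lintegral_mono fun w => ?_
        by_cases hw : w ∈ Ω ∧ 2 * δ < ‖x - w‖
        · simp [hw, hΩ w hw.1, norm_sub_rev w x]
        · simp [indicator_apply, hw]
    _ ≤ ENNReal.ofReal (5 * Real.pi / (4 * δ)) :=
        lintegral_halfSpace_inv_norm_pow_four_le hδ hν
    _ ≤ ENNReal.ofReal (3 * Real.pi / (2 * δ)) := by
        refine ENNReal.ofReal_le_ofReal ?_
        rw [div_le_div_iff₀ (by positivity) (by positivity)]
        nlinarith [mul_pos Real.pi_pos hδ]
end

section
/- Let Ω ⊆ ℝ² be a nonempty open bounded convex set, let x ∈ Ω, set δ = dist(x, ∂Ω) > 0 and let D = diam(Ω) be the diameter of Ω. Then ∫_{{w ∈ Ω : ‖x − w‖ > 2δ}} ‖x − w‖^{−2} dw ≤ (4π/3)·ln(D/δ), where the integral is taken with respect to Lebesgue measure on ℝ². -/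
open MeasureTheory Set

/-- A convex open set lies in a half-plane whose boundary passes at distance at most `dist x z`
from `x`, for any `z` outside the set. -/
theorem exists_unit_inner_sub_lt_dist {E : Type*} [NormedAddCommGroup E] [InnerProductSpace ℝ E]
    [CompleteSpace E] {Ω : Set E} (hopen : IsOpen Ω) (hconv : Convex ℝ Ω) {x z : E}
    (hx : x ∈ Ω) (hz : z ∉ Ω) :
    ∃ n : E, ‖n‖ = 1 ∧ ∀ w ∈ Ω, inner ℝ n (w - x) < dist x z := by
  obtain ⟨f, hf⟩ := geometric_hahn_banach_open_point hconv hopen hz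
  set v := (InnerProductSpace.toDual ℝ E).symm f
  have hfv : ∀ w, inner ℝ v w = f w := fun w => InnerProductSpace.toDual_symm_apply
  have hv0 : v ≠ 0 := by
    intro h
    have := hf x hx
    rw [← hfv, ← hfv, h] at this
    simp at this
  have hpos : 0 < ‖v‖ := norm_pos_iff.mpr hv0
  refine ⟨‖v‖⁻¹ • v, ?_, fun w hw => ?_⟩
  · rw [norm_smul, norm_inv, norm_norm, inv_mul_cancel₀ hpos.ne']
  · have h1 : inner ℝ v (w - x) < inner ℝ v (z - x) := by
      simp only [hfv, map_sub]
      linarith [hf w hw]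
    have h2 : inner ℝ v (z - x) ≤ ‖v‖ * ‖z - x‖ := real_inner_le_norm v (z - x)
    rw [real_inner_smul_left, dist_comm, dist_eq_norm, inv_mul_lt_iff₀ hpos]
    linarith

theorem neg_half_lt_cos_iff {θ : ℝ} (hθ : θ ∈ Ioo (-Real.pi) Real.pi) :
    -(1 / 2) < Real.cos θ ↔ θ ∈ Ioo (-(2 * Real.pi / 3)) (2 * Real.pi / 3) := by
  have hc : Real.cos (2 * Real.pi / 3) = -(1 / 2) := by
    rw [show 2 * Real.pi / 3 = Real.pi - Real.pi / 3 by ring, Real.cos_pi_sub,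
      Real.cos_pi_div_three]
  have hp := Real.pi_pos
  rw [← hc, ← Real.cos_abs θ, mem_Ioo, ← abs_lt]
  exact Real.strictAntiOn_cos.lt_iff_gt ⟨by positivity, by linarith⟩
    ⟨abs_nonneg θ, (abs_lt.mpr hθ).le⟩

/-- The integral of `‖u‖⁻²` over a truncated sector of opening `4π/3`. -/
theorem Complex.setIntegral_inv_norm_sq_sector {a b : ℝ} (ha : 0 < a) (hab : a ≤ b) :
    ∫ u in {u : ℂ | (a < ‖u‖ ∧ ‖u‖ ≤ b) ∧ -(‖u‖ / 2) < u.re}, (‖u‖ ^ 2)⁻¹ =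
      4 * Real.pi / 3 * Real.log (b / a) := by
  have hp := Real.pi_pos
  have hmeas : MeasurableSet {u : ℂ | (a < ‖u‖ ∧ ‖u‖ ≤ b) ∧ -(‖u‖ / 2) < u.re} := by
    measurability
  have hsub : Ioc a b ×ˢ Ioo (-(2 * Real.pi / 3)) (2 * Real.pi / 3) ⊆ polarCoord.target := by
    rintro ⟨r, θ⟩ ⟨hr, hθ⟩
    exact ⟨ha.trans hr.1, by linarith [hθ.1], by linarith [hθ.2]⟩
  rw [← integral_indicator hmeas, ← Complex.integral_comp_polarCoord_symm]
  have hpolar : ∫ p in polarCoord.target,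
      p.1 • ({u : ℂ | (a < ‖u‖ ∧ ‖u‖ ≤ b) ∧ -(‖u‖ / 2) < u.re}.indicator
        (fun u => (‖u‖ ^ 2)⁻¹) (Complex.polarCoord.symm p)) =
      ∫ p in polarCoord.target,
        (Ioc a b ×ˢ Ioo (-(2 * Real.pi / 3)) (2 * Real.pi / 3)).indicator
          (fun p : ℝ × ℝ => p.1⁻¹ * 1) p := by
    refine setIntegral_congr_fun polarCoord.open_target.measurableSet ?_
    rintro ⟨r, θ⟩ ⟨hr, hθ⟩
    have hr : 0 < r := hr
    have hnorm : ‖Complex.polarCoord.symm (r, θ)‖ = r := by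
      rw [Complex.norm_polarCoord_symm, abs_of_pos hr]
    have hre : (Complex.polarCoord.symm (r, θ)).re = r * Real.cos θ := by
      simp [Complex.polarCoord_symm_apply, Complex.cos_ofReal_re, Complex.sin_ofReal_im]
    have hiff : Complex.polarCoord.symm (r, θ) ∈
        {u : ℂ | (a < ‖u‖ ∧ ‖u‖ ≤ b) ∧ -(‖u‖ / 2) < u.re} ↔
        (r, θ) ∈ Ioc a b ×ˢ Ioo (-(2 * Real.pi / 3)) (2 * Real.pi / 3) := by
      rw [mem_ofPred_eq, hnorm, hre, mem_prod, ← neg_half_lt_cos_iff hθ, mem_Ioc,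
        show -(r / 2) = r * -(1 / 2) by ring, mul_lt_mul_iff_right₀ hr]
    by_cases h : (r, θ) ∈ Ioc a b ×ˢ Ioo (-(2 * Real.pi / 3)) (2 * Real.pi / 3)
    · simp only [indicator_of_mem h, indicator_of_mem (hiff.mpr h), hnorm, smul_eq_mul]
      field_simp
    · simp only [indicator_of_notMem h, indicator_of_notMem (mt hiff.mp h), smul_zero]
  rw [hpolar, setIntegral_indicator (measurableSet_Ioc.prod measurableSet_Ioo),
    inter_eq_self_of_subset_right hsub, Measure.volume_eq_prod,
    setIntegral_prod_mul (fun r : ℝ => r⁻¹) (fun _ : ℝ => (1 : ℝ)),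
    ← intervalIntegral.integral_of_le hab, integral_inv_of_pos ha (ha.trans_le hab)]
  simp only [integral_const, MeasurableSet.univ, measureReal_restrict_apply, univ_inter,
    Real.volume_real_Ioo, smul_eq_mul]
  rw [max_eq_left (by linarith)]
  ring

/-- For a unit vector `n` of the Euclidean plane, there is a linear isometry onto `ℂ` sending
`n` to `-1`. -/
theorem exists_linearIsometryEquiv_complex_re {n : EuclideanSpace ℝ (Fin 2)} (hn : ‖n‖ = 1) :
    ∃ L : EuclideanSpace ℝ (Fin 2) ≃ₗᵢ[ℝ] ℂ, ∀ v, (L v).re = -inner ℝ n v := by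
  let L₀ := Complex.orthonormalBasisOneI.repr.symm
  have hc : ‖-(starRingEnd ℂ) (L₀ n)‖ = 1 := by simp [hn]
  let c : Circle := ⟨-(starRingEnd ℂ) (L₀ n), mem_sphere_zero_iff_norm.mpr hc⟩
  refine ⟨L₀.trans (rotation c), fun v => ?_⟩
  rw [← L₀.inner_map_map n v, Complex.inner]
  rw [LinearIsometryEquiv.trans_apply, rotation_apply, ← Complex.neg_re, mul_comm (L₀ v),
    ← neg_mul]

theorem setIntegral_inv_norm_sq_sector {n : EuclideanSpace ℝ (Fin 2)} (hn : ‖n‖ = 1)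
    (x : EuclideanSpace ℝ (Fin 2)) {a b : ℝ} (ha : 0 < a) (hab : a ≤ b) :
    ∫ w in {w | (a < ‖x - w‖ ∧ ‖x - w‖ ≤ b) ∧ inner ℝ n (w - x) < ‖x - w‖ / 2},
      (‖x - w‖ ^ 2)⁻¹ = 4 * Real.pi / 3 * Real.log (b / a) := by
  obtain ⟨L, hL⟩ := exists_linearIsometryEquiv_complex_re hn
  have hmp : MeasurePreserving (fun w => L (w - x)) :=
    L.measurePreserving.comp (measurePreserving_sub_right volume x)
  have hemb : MeasurableEmbedding (fun w => L (w - x)) :=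
    L.toHomeomorph.measurableEmbedding.comp (measurableEmbedding_subRight x)
  rw [← Complex.setIntegral_inv_norm_sq_sector ha hab, ← hmp.setIntegral_preimage_emb hemb]
  simp only [preimage_ofPred_eq, L.norm_map, hL, neg_lt_neg_iff, norm_sub_rev _ x]

/-- **Interior area-integral estimate in a bounded convex domain of `ℝ²`.**
If `Ω ⊆ ℝ²` is a nonempty open bounded convex set and `x ∈ Ω`, then with
`δ = dist(x, ∂Ω) > 0` and `D = diam Ω` one has
`∫_{w ∈ Ω, ‖x − w‖ > 2δ} ‖x − w‖⁻² dw ≤ (4π/3)·ln(D/δ)`. -/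
theorem stmt2 (Ω : Set (EuclideanSpace ℝ (Fin 2)))
    (hopen : IsOpen Ω) (hbd : Bornology.IsBounded Ω) (hconv : Convex ℝ Ω) (hne : Ω.Nonempty)
    (x : EuclideanSpace ℝ (Fin 2)) (hx : x ∈ Ω) :
    0 < Metric.infDist x (frontier Ω) ∧
    ∫ w in {w | w ∈ Ω ∧ 2 * Metric.infDist x (frontier Ω) < ‖x - w‖}, (‖x - w‖ ^ 2)⁻¹ ≤
      4 * Real.pi / 3 * Real.log (Metric.diam Ω / Metric.infDist x (frontier Ω)) := by
  have hfr : (frontier Ω).Nonempty := by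
    refine nonempty_frontier_iff.mpr ⟨hne, fun h => ?_⟩
    exact NormedSpace.unbounded_univ ℝ (EuclideanSpace ℝ (Fin 2)) (h ▸ hbd)
  have hdisj : ∀ z ∈ frontier Ω, z ∉ Ω := fun z hz => by
    rw [hopen.frontier_eq] at hz
    exact hz.2
  have hpos : 0 < Metric.infDist x (frontier Ω) :=
    (isClosed_frontier.notMem_iff_infDist_pos hfr).mp fun h => hdisj x h hx
  refine ⟨hpos, ?_⟩
  obtain ⟨z, hz, hxz⟩ := isClosed_frontier.exists_infDist_eq_dist hfr x
  obtain ⟨n, hn, hin⟩ := exists_unit_inner_sub_lt_dist hopen hconv hx (hdisj z hz)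
  rw [← hxz] at hin
  have hδD : Metric.infDist x (frontier Ω) ≤ Metric.diam Ω := by
    rw [hxz, ← Metric.diam_closure]
    exact Metric.dist_le_diam_of_mem hbd.closure (subset_closure hx) (frontier_subset_closure hz)
  generalize Metric.infDist x (frontier Ω) = δ at *
  rw [← setIntegral_inv_norm_sq_sector hn x hpos hδD]
  set S := {w | (δ < ‖x - w‖ ∧ ‖x - w‖ ≤ Metric.diam Ω) ∧ inner ℝ n (w - x) < ‖x - w‖ / 2}
  have hSm : MeasurableSet S := by measurability
  refine setIntegral_mono_set ?_ (Filter.Eventually.of_forall fun w => by positivity) ?_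
  · refine IntegrableOn.of_bound (C := (δ ^ 2)⁻¹) ?_ (by fun_prop) ?_
    · refine (measure_mono (t := Metric.closedBall x (Metric.diam Ω)) fun w hw => ?_).trans_lt
        measure_closedBall_lt_top
      rw [Metric.mem_closedBall, dist_comm, dist_eq_norm]
      exact hw.1.2
    · refine (ae_restrict_iff' hSm).mpr (Filter.Eventually.of_forall fun w hw => ?_)
      rw [norm_inv, norm_pow, norm_norm]
      gcongr
      exact hw.1.1.le
  · refine (show _ ⊆ S from fun w hw => ⟨⟨?_, ?_⟩, ?_⟩).eventuallyLE
    · linarith [hw.2]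
    · rw [← dist_eq_norm]
      exact Metric.dist_le_diam_of_mem hbd hx hw.1
    · linarith [hw.2, hin w hw.1]
end

section
/- Let d ≥ 3 be an integer and let Ω ⊆ ℝ^d be a nonempty open bounded convex set. Set G(x,y) = ‖x − y‖^{2−d}/((2−d)·ω_d). Suppose g : Ω × Ω → ℝ is such that for every y ∈ Ω the function x ↦ g(x,y) is harmonic on Ω, extends continuously to the closure of Ω, and satisfies g(x,y) = −G(x,y) for every x ∈ ∂Ω. Then there exist constants c₁, c₂ > 0 such that g(x,x) ≥ c₂ · dist(x, ∂Ω)^{2−d} − c₁ for every x ∈ Ω. -/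
open scoped BigOperators

/-- The surface area `ω_d = 2π^{d/2}/Γ(d/2)` of the unit sphere in `ℝ^d`. -/
noncomputable def sphereArea (d : ℕ) : ℝ :=
  2 * Real.pi ^ ((d : ℝ) / 2) / Real.Gamma ((d : ℝ) / 2)

/-- The fundamental solution `G(x,y) = ‖x − y‖^{2−d}/((2−d)·ω_d)` of the Laplacian in `ℝ^d`,
`d ≥ 3`. -/
noncomputable def fundSol (d : ℕ) (x y : EuclideanSpace ℝ (Fin d)) : ℝ :=
  ‖x - y‖ ^ ((2 : ℝ) - d) / (((2 : ℝ) - d) * sphereArea d)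

/-- `u` is harmonic on the open set `U`: it is twice continuously differentiable there and its
Laplacian `Δu = Σᵢ ∂²u/∂xᵢ²` vanishes on `U`. -/
def IsHarmonicOn {d : ℕ} (u : EuclideanSpace ℝ (Fin d) → ℝ)
    (U : Set (EuclideanSpace ℝ (Fin d))) : Prop :=
  ContDiffOn ℝ 2 u U ∧
    ∀ x ∈ U, ∑ i : Fin d,
      iteratedFDerivWithin ℝ 2 u U x ![EuclideanSpace.single i 1, EuclideanSpace.single i 1] = 0

open Filter Topology Set

/-- Necessary second-order condition at a local maximum of a function of one real variable. -/
lemma second_deriv_nonpos_of_isLocalMax {φ φ' : ℝ → ℝ} {a c : ℝ}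
    (h1 : ∀ᶠ s in 𝓝 a, HasDerivAt φ (φ' s) s) (h2 : HasDerivAt φ' c a)
    (hmax : IsLocalMax φ a) : c ≤ 0 := by
  by_contra! hc
  have hd : deriv φ =ᶠ[𝓝 a] φ' := h1.mono fun s hs => hs.deriv
  have hdd : deriv (deriv φ) a = c := by rw [hd.deriv_eq, h2.deriv]
  have hmin : IsLocalMin φ a :=
    isLocalMin_of_deriv_deriv_pos (by rwa [hdd]) hmax.deriv_eq_zero
      h1.self_of_nhds.continuousAt
  have hconst : φ =ᶠ[𝓝 a] fun _ => φ a := by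
    filter_upwards [hmin, hmax] with s hs1 hs2 using le_antisymm hs2 hs1
  have hzero : deriv (deriv φ) a = 0 := by
    rw [hconst.deriv.deriv_eq]
    simp
  exact hc.ne' (hdd.symm.trans hzero)

/-- First and second derivatives of a `C²` function along a line. -/
lemma hasDerivAt_line_of_contDiffAt {E : Type*} [NormedAddCommGroup E] [NormedSpace ℝ E]
    {u : E → ℝ} {w e : E} (hu : ContDiffAt ℝ 2 u w) :
    (∀ᶠ s in 𝓝 (0 : ℝ), HasDerivAt (fun s : ℝ => u (w + s • e)) (fderiv ℝ u (w + s • e) e) s) ∧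
      HasDerivAt (fun s : ℝ => fderiv ℝ u (w + s • e) e)
        (iteratedFDeriv ℝ 2 u w ![e, e]) 0 := by
  have hline : ∀ s : ℝ, HasDerivAt (fun s : ℝ => w + s • e) e s := fun s => by
    simpa using ((hasDerivAt_id s).smul_const e).const_add w
  have htend : Tendsto (fun s : ℝ => w + s • e) (𝓝 0) (𝓝 w) := by
    simpa using (hline 0).continuousAt.tendsto
  constructor
  · have hev : ∀ᶠ y in 𝓝 w, ContDiffAt ℝ 2 u y := hu.eventually (by simp)
    filter_upwards [htend.eventually hev] with s hs
    have hfd : HasFDerivAt u (fderiv ℝ u (w + s • e)) (w + s • e) :=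
      (hs.differentiableAt two_ne_zero).hasFDerivAt
    exact hfd.comp_hasDerivAt s (hline s)
  · have hf : HasFDerivAt (fderiv ℝ u) (fderiv ℝ (fderiv ℝ u) w) (w + (0 : ℝ) • e) := by
      have h1 : ContDiffAt ℝ 1 (fderiv ℝ u) w := hu.fderiv_right (by norm_num)
      simpa using (h1.differentiableAt one_ne_zero).hasFDerivAt
    have hc : HasDerivAt (fun s : ℝ => fderiv ℝ u (w + s • e))
        (fderiv ℝ (fderiv ℝ u) w e) 0 := hf.comp_hasDerivAt (0 : ℝ) (hline 0)
    have happ := hc.clm_apply (hasDerivAt_const (0 : ℝ) e)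
    rw [iteratedFDeriv_two_apply]
    simpa using happ

lemma hasDerivAt_quadratic (A B s : ℝ) :
    HasDerivAt (fun s : ℝ => A + 2 * s * B + s ^ 2) (2 * B + 2 * s) s := by
  simpa using ((((hasDerivAt_id' s).const_mul 2).mul_const B).const_add A).fun_add
    (hasDerivAt_pow 2 s)

/-- First and second derivatives of a real power of a positive quadratic polynomial. -/
lemma hasDerivAt_quadratic_rpow (A B p : ℝ) (hA : 0 < A) :
    (∀ᶠ s in 𝓝 (0 : ℝ), HasDerivAt (fun s : ℝ => (A + 2 * s * B + s ^ 2) ^ p)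
      ((2 * B + 2 * s) * p * (A + 2 * s * B + s ^ 2) ^ (p - 1)) s) ∧
    HasDerivAt (fun s : ℝ => (2 * B + 2 * s) * p * (A + 2 * s * B + s ^ 2) ^ (p - 1))
      (2 * p * A ^ (p - 1) + 4 * B ^ 2 * p * (p - 1) * A ^ (p - 2)) 0 := by
  have hq := hasDerivAt_quadratic A B
  constructor
  · have hpos : ∀ᶠ s in 𝓝 (0 : ℝ), 0 < A + 2 * s * B + s ^ 2 :=
      (hq 0).continuousAt.eventually_const_lt (by simpa using hA)
    filter_upwards [hpos] with s hs
    exact (hq s).rpow_const (Or.inl hs.ne')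
  · have h1 : HasDerivAt (fun s : ℝ => (2 * B + 2 * s) * p) (2 * p) 0 := by
      simpa using (((hasDerivAt_id (0 : ℝ)).const_mul 2).const_add (2 * B)).mul_const p
    have h2 := (hq 0).rpow_const (p := p - 1) (Or.inl (by simpa using hA.ne'))
    have h3 := h1.fun_mul h2
    refine h3.congr_deriv ?_
    have : p - 1 - 1 = p - 2 := by ring
    simp only [mul_zero, zero_mul, add_zero, ne_eq, OfNat.ofNat_ne_zero, not_false_eq_true,
      zero_pow, this]
    ring

/-- Comparison principle: a harmonic function that dominates `C‖· - b‖^(2-d)` on the frontier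
of a bounded open set, with the pole `b` outside the set, dominates it inside. -/
lemma riesz_kernel_le_of_frontier {d : ℕ} {Ω : Set (EuclideanSpace ℝ (Fin d))}
    (hd : 0 < d) (hopen : IsOpen Ω) (hbd : Bornology.IsBounded Ω)
    {u : EuclideanSpace ℝ (Fin d) → ℝ} (hu : IsHarmonicOn u Ω)
    (hcont : ContinuousOn u (closure Ω)) {b : EuclideanSpace ℝ (Fin d)} (hb : b ∉ closure Ω)
    {C : ℝ} (hfr : ∀ w ∈ frontier Ω, C * ‖w - b‖ ^ ((2 : ℝ) - d) ≤ u w)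
    {x : EuclideanSpace ℝ (Fin d)} (hx : x ∈ Ω) :
    C * ‖x - b‖ ^ ((2 : ℝ) - d) ≤ u x := by
  set p : ℝ := ((2 : ℝ) - d) / 2 with hp
  have hpow : ∀ w : EuclideanSpace ℝ (Fin d), ‖w - b‖ ^ ((2 : ℝ) - d) = (‖w - b‖ ^ 2) ^ p := by
    intro w
    rw [← Real.rpow_natCast, ← Real.rpow_mul (norm_nonneg _)]
    congr 1
    rw [hp]; push_cast; ring
  have hpos : ∀ w ∈ closure Ω, 0 < ‖w - b‖ ^ 2 := by
    intro w hw
    have : w - b ≠ 0 := sub_ne_zero.2 fun h => hb (h ▸ hw)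
    positivity
  have hcpt : IsCompact (closure Ω) := hbd.isCompact_closure
  obtain ⟨M, hM⟩ := hcpt.exists_bound_of_continuousOn
    (f := fun w : EuclideanSpace ℝ (Fin d) => ‖w - b‖ ^ 2) (by fun_prop)
  by_contra! hlt
  obtain ⟨ε, hε, hεM⟩ : ∃ ε > 0, ε * M < C * ‖x - b‖ ^ ((2 : ℝ) - d) - u x := by
    have hδ : 0 < C * ‖x - b‖ ^ ((2 : ℝ) - d) - u x := sub_pos.2 hlt
    have hM0 : 0 ≤ M := (norm_nonneg _).trans (hM x (subset_closure hx))
    refine ⟨(C * ‖x - b‖ ^ ((2 : ℝ) - d) - u x) / (M + 1), by positivity, ?_⟩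
    rw [div_mul_eq_mul_div, div_lt_iff₀ (by positivity)]
    nlinarith
  set F : EuclideanSpace ℝ (Fin d) → ℝ := fun w =>
    C * (‖w - b‖ ^ 2) ^ p - u w + ε * ‖w - b‖ ^ 2 with hF
  have hFc : ContinuousOn F (closure Ω) := by
    refine ((ContinuousOn.rpow_const (by fun_prop) fun w hw => Or.inl (hpos w hw).ne').const_smul
      C |>.sub hcont).add (by fun_prop)
  obtain ⟨w, hwc, hwmax⟩ := hcpt.exists_isMaxOn ⟨x, subset_closure hx⟩ hFc
  have hFx : ε * M < F x := by
    have : 0 ≤ ε * ‖x - b‖ ^ 2 := by positivity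
    simp only [hF, ← hpow]
    linarith
  have hw : w ∈ Ω := by
    by_contra hw
    have hwf : w ∈ frontier Ω := by
      rw [hopen.frontier_eq]
      exact ⟨hwc, hw⟩
    have h1 := hfr w hwf
    have h2 : F x ≤ F w := hwmax (subset_closure hx)
    have h3 : ε * ‖w - b‖ ^ 2 ≤ ε * M :=
      mul_le_mul_of_nonneg_left ((le_abs_self _).trans (hM w hwc)) hε.le
    simp only [hF, ← hpow] at h2 hFx
    linarith
  have hloc : IsLocalMax F w :=
    (hwmax.on_subset subset_closure).isLocalMax (hopen.mem_nhds hw)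
  have hA := hpos w hwc
  set A : ℝ := ‖w - b‖ ^ 2 with hAdef
  have hcd : ContDiffAt ℝ 2 u w := hu.1.contDiffAt (hopen.mem_nhds hw)
  have key : ∀ i : Fin d,
      C * (2 * p * A ^ (p - 1) + 4 * (w - b) i ^ 2 * p * (p - 1) * A ^ (p - 2)) -
        iteratedFDeriv ℝ 2 u w ![EuclideanSpace.single i 1, EuclideanSpace.single i 1] +
        ε * 2 ≤ 0 := by
    intro i
    set e : EuclideanSpace ℝ (Fin d) := EuclideanSpace.single i 1 with he
    set B : ℝ := (w - b) i with hB
    have hsq : ∀ s : ℝ, ‖w + s • e - b‖ ^ 2 = A + 2 * s * B + s ^ 2 := by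
      intro s
      have hrw : w + s • e - b = (w - b) + s • e := by abel
      rw [hrw, norm_add_sq_real, inner_smul_right, norm_smul, he,
        EuclideanSpace.inner_single_right]
      simp [hB, hAdef]
      ring
    obtain ⟨hu1, hu2⟩ := hasDerivAt_line_of_contDiffAt (e := e) hcd
    obtain ⟨hq1, hq2⟩ := hasDerivAt_quadratic_rpow A B p hA
    have hr2 : HasDerivAt (fun s : ℝ => 2 * B + 2 * s) 2 0 := by
      simpa using ((hasDerivAt_id (0 : ℝ)).const_mul 2).const_add (2 * B)
    have hφ : IsLocalMax (fun s : ℝ => C * (A + 2 * s * B + s ^ 2) ^ p - u (w + s • e) +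
        ε * (A + 2 * s * B + s ^ 2)) 0 := by
      have hcts : ContinuousAt (fun s : ℝ => w + s • e) 0 := by fun_prop
      have hl : IsLocalMax (F ∘ fun s : ℝ => w + s • e) 0 := by
        have : Tendsto (fun s : ℝ => w + s • e) (𝓝 0) (𝓝 w) := by
          simpa using hcts.tendsto
        have h := this.eventually hloc
        simpa [IsLocalMax, IsMaxFilter] using h
      simpa only [Function.comp_def, hF, hsq] using hl
    refine second_deriv_nonpos_of_isLocalMax (a := 0) ?_
      (((hq2.const_mul C).sub hu2).add (hr2.const_mul ε)) hφ
    filter_upwards [hu1, hq1] with s hs1 hs2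
    exact ((hs2.const_mul C).sub hs1).add ((hasDerivAt_quadratic A B s).const_mul ε)
  have hlap : ∑ i : Fin d, iteratedFDeriv ℝ 2 u w
      ![EuclideanSpace.single i 1, EuclideanSpace.single i 1] = 0 := by
    have := hu.2 w hw
    rwa [iteratedFDerivWithin_of_isOpen 2 hopen hw] at this
  have hnorm : ∑ i : Fin d, (w - b) i ^ 2 = A := by
    rw [hAdef, EuclideanSpace.real_norm_sq_eq]
  have hsum := Finset.sum_nonpos fun i (_ : i ∈ Finset.univ) => key i
  have hAp : A ^ (p - 1) = A * A ^ (p - 2) := by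
    rw [mul_comm, ← Real.rpow_add_one hA.ne']
    congr 1
    ring
  have hkernel : ∑ i : Fin d,
      C * (2 * p * A ^ (p - 1) + 4 * (w - b) i ^ 2 * p * (p - 1) * A ^ (p - 2)) = 0 := by
    rw [← Finset.mul_sum, Finset.sum_add_distrib]
    simp only [← Finset.sum_mul, ← Finset.mul_sum, hnorm, hAp, Finset.sum_const, Finset.card_univ, Fintype.card_fin, nsmul_eq_mul]
    have hdp : (d : ℝ) = 2 - 2 * p := by rw [hp]; ring
    rw [hdp]
    ring
  rw [Finset.sum_add_distrib, Finset.sum_sub_distrib, hkernel, hlap] at hsum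
  simp only [Finset.sum_const, Finset.card_univ, Fintype.card_fin, nsmul_eq_mul] at hsum
  have : (0 : ℝ) < d := by exact_mod_cast hd
  have : 0 < (d : ℝ) * (ε * 2) := by positivity
  linarith

/-- Reflecting a point `x` of an open convex set in a supporting hyperplane at `z` gives a point
outside the closure that is farther than `x` from each point of the closure. -/
lemma exists_reflection_of_convex {E : Type*} [NormedAddCommGroup E] [InnerProductSpace ℝ E]
    [CompleteSpace E] {Ω : Set E} (hopen : IsOpen Ω) (hconv : Convex ℝ Ω) {x z : E} (hx : x ∈ Ω)
    (hz : z ∉ Ω) :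
    ∃ b, b ∉ closure Ω ∧ ‖x - b‖ ≤ 2 * ‖x - z‖ ∧ ∀ w ∈ closure Ω, ‖w - x‖ ≤ ‖w - b‖ := by
  obtain ⟨f, hf⟩ := geometric_hahn_banach_open_point hconv hopen hz
  set v : E := (InnerProductSpace.toDual ℝ E).symm f with hv
  have hvf : ∀ a, inner ℝ v a = f a := fun a => by
    rw [hv, InnerProductSpace.toDual_symm_apply]
  have hfc : ∀ w ∈ closure Ω, f w ≤ f z := by
    have hcl : IsClosed {w | f w ≤ f z} := isClosed_le f.continuous continuous_const
    exact fun w hw => closure_minimal (fun a ha => (hf a ha).le) hcl hw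
  have hxz : 0 < f z - f x := sub_pos.2 (hf x hx)
  have hv0 : v ≠ 0 := by
    intro h
    have h1 := hvf z
    have h2 := hvf x
    simp only [h, inner_zero_left] at h1 h2
    linarith
  have hvn : 0 < ‖v‖ := norm_pos_iff.2 hv0
  set t : ℝ := (f z - f x) / ‖v‖ ^ 2 with ht
  have ht0 : 0 < t := by positivity
  have htv : t * ‖v‖ ^ 2 = f z - f x := by
    rw [ht]; field_simp
  refine ⟨x + (2 * t) • v, fun hmem => ?_, ?_, fun w hw => ?_⟩
  · have h := hfc _ hmem
    rw [← hvf, inner_add_right, inner_smul_right, real_inner_self_eq_norm_sq, hvf] at h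
    linarith
  · have hcs : f z - f x ≤ ‖v‖ * ‖x - z‖ := by
      rw [← hvf, ← hvf, ← inner_sub_right, norm_sub_rev]
      exact real_inner_le_norm _ _
    have hle : t * ‖v‖ ≤ ‖x - z‖ := by
      refine le_of_mul_le_mul_left ?_ hvn
      linarith [show ‖v‖ * (t * ‖v‖) = t * ‖v‖ ^ 2 by ring]
    rw [sub_add_cancel_left, norm_neg, norm_smul, Real.norm_of_nonneg (by positivity)]
    linarith
  · have h := hfc w hw
    have hrw : w - (x + (2 * t) • v) = (w - x) - (2 * t) • v := by abel
    refine le_of_sq_le_sq ?_ (norm_nonneg _)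
    rw [hrw, norm_sub_sq_real (w - x), inner_smul_right, real_inner_comm, inner_sub_right, hvf,
      hvf, norm_smul, Real.norm_of_nonneg (by positivity : 0 ≤ 2 * t)]
    have : 0 ≤ 4 * t * (f z - f w) := mul_nonneg (by positivity) (by linarith)
    nlinarith

/-- **Lower bound for the Dirichlet Robin function, `d ≥ 3`.**
If `g(·,y)` is the regular part of the Dirichlet Green function of a nonempty open bounded
convex set `Ω ⊆ ℝ^d` (harmonic in `x`, continuous up to the closure, equal to `−G` on the
frontier), then there are `c₁, c₂ > 0` with
`g(x,x) ≥ c₂·dist(x,∂Ω)^{2−d} − c₁` for all `x ∈ Ω`. -/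
theorem stmt3 (d : ℕ) (hd : 3 ≤ d) (Ω : Set (EuclideanSpace ℝ (Fin d)))
    (hopen : IsOpen Ω) (hbd : Bornology.IsBounded Ω) (hconv : Convex ℝ Ω) (hne : Ω.Nonempty)
    (g : EuclideanSpace ℝ (Fin d) → EuclideanSpace ℝ (Fin d) → ℝ)
    (hharm : ∀ y ∈ Ω, IsHarmonicOn (fun x => g x y) Ω)
    (hcont : ∀ y ∈ Ω, ContinuousOn (fun x => g x y) (closure Ω))
    (hbdry : ∀ y ∈ Ω, ∀ x ∈ frontier Ω, g x y = -fundSol d x y) :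
    ∃ c₁ > 0, ∃ c₂ > 0, ∀ x ∈ Ω,
      c₂ * Metric.infDist x (frontier Ω) ^ ((2 : ℝ) - d) - c₁ ≤ g x x := by
  have hd0 : 0 < d := by omega
  have hdR : (3 : ℝ) ≤ d := by exact_mod_cast hd
  have hexp : (2 : ℝ) - d ≤ 0 := by linarith
  have hω : 0 < sphereArea d := by
    have : 0 < Real.Gamma ((d : ℝ) / 2) := Real.Gamma_pos_of_pos (by positivity)
    unfold sphereArea
    positivity
  set C : ℝ := 1 / (((d : ℝ) - 2) * sphereArea d) with hC
  have hCpos : 0 < C := one_div_pos.2 (mul_pos (by linarith) hω)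
  have hG : ∀ x y, -fundSol d x y = C * ‖x - y‖ ^ ((2 : ℝ) - d) := by
    intro x y
    rw [fundSol, hC, ← div_neg, ← neg_mul, neg_sub, one_div, div_eq_inv_mul]
  have hfne : (frontier Ω).Nonempty := by
    have : Nonempty (Fin d) := ⟨⟨0, hd0⟩⟩
    refine nonempty_frontier_iff.2 ⟨hne, fun h => ?_⟩
    exact NormedSpace.unbounded_univ ℝ (EuclideanSpace ℝ (Fin d)) (h ▸ hbd)
  refine ⟨1, one_pos, C * 2 ^ ((2 : ℝ) - d), by positivity, fun x hx => ?_⟩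
  obtain ⟨z, hzf, hz⟩ := isClosed_frontier.exists_infDist_eq_dist hfne x
  have hnot : ∀ w ∈ frontier Ω, w ∉ Ω := fun w hw => by
    rw [hopen.frontier_eq] at hw
    exact hw.2
  obtain ⟨b, hb, hbx, hbw⟩ := exists_reflection_of_convex hopen hconv hx (hnot z hzf)
  have hmain : C * ‖x - b‖ ^ ((2 : ℝ) - d) ≤ g x x := by
    refine riesz_kernel_le_of_frontier hd0 hopen hbd (hharm x hx) (hcont x hx) hb
      (fun w hw => ?_) hx
    have hwx : 0 < ‖w - x‖ := norm_pos_iff.2 (sub_ne_zero.2 fun h => hnot w hw (h ▸ hx))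
    simp only [hbdry x hx w hw, hG]
    exact mul_le_mul_of_nonneg_left
      (Real.rpow_le_rpow_of_nonpos hwx (hbw w (frontier_subset_closure hw)) hexp) hCpos.le
  have hxb : 0 < ‖x - b‖ :=
    norm_pos_iff.2 (sub_ne_zero.2 fun h => hb (h ▸ subset_closure hx))
  have hle := mul_le_mul_of_nonneg_left (Real.rpow_le_rpow_of_nonpos hxb hbx hexp) hCpos.le
  rw [Real.mul_rpow two_pos.le (norm_nonneg _), ← mul_assoc] at hle
  rw [hz, dist_eq_norm]
  linarith
end

section
/- Let Ω ⊆ ℝ² be a nonempty open bounded convex set. Set G(x,y) = (1/(2π))·ln‖x − y‖. Suppose g : Ω × Ω → ℝ is such that for every y ∈ Ω the function x ↦ g(x,y) is harmonic on Ω, extends continuously to the closure of Ω, and satisfies g(x,y) = −G(x,y) for every x ∈ ∂Ω. Then there exist constants c₁, c₂ > 0 such that g(x,x) ≥ −c₂ · ln dist(x, ∂Ω) − c₁ for every x ∈ Ω. -/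
open scoped BigOperators

/-- The planar fundamental solution `G(x,y) = (1/(2π))·ln ‖x − y‖` of the Laplacian in `ℝ²`. -/
noncomputable def fundSol2 (x y : EuclideanSpace ℝ (Fin 2)) : ℝ :=
  (1 / (2 * Real.pi)) * Real.log ‖x - y‖

open Set Filter Topology InnerProductSpace

local notation "ℝ²" => EuclideanSpace ℝ (Fin 2)

/-- The second derivative of the restriction of `u` to a line. -/
theorem deriv_deriv_comp_line {E : Type*} [NormedAddCommGroup E] [NormedSpace ℝ E]
    {u : E → ℝ} {x : E} (hu : ContDiffAt ℝ 2 u x) (e : E) :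
    deriv (deriv fun t : ℝ => u (x + t • e)) 0 = iteratedFDeriv ℝ 2 u x ![e, e] := by
  have hline : ∀ t : ℝ, HasDerivAt (fun t : ℝ => x + t • e) e t := fun t => by
    simpa using ((hasDerivAt_id t).smul_const e).const_add x
  have hx : x + (0 : ℝ) • e = x := by simp
  have hev : ∀ᶠ t in 𝓝 (0 : ℝ), ContDiffAt ℝ 2 u (x + t • e) := by
    have h := (hline 0).continuousAt.tendsto
    rw [hx] at h
    exact h.eventually (hu.eventually (by decide))
  have hd : deriv (fun t : ℝ => u (x + t • e)) =ᶠ[𝓝 0] fun t => fderiv ℝ u (x + t • e) e := by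
    filter_upwards [hev] with t ht
    exact ((ht.differentiableAt two_ne_zero).hasFDerivAt.comp_hasDerivAt t (hline t)).deriv
  rw [hd.deriv_eq, iteratedFDeriv_two_apply]
  have h2 : HasFDerivAt (fderiv ℝ u) (fderiv ℝ (fderiv ℝ u) x) (x + (0 : ℝ) • e) := by
    rw [hx]
    have h1 : ContDiffAt ℝ 1 (fderiv ℝ u) x := hu.fderiv_right (by norm_num [one_add_one_eq_two])
    exact (h1.differentiableAt one_ne_zero).hasFDerivAt
  have h3 : HasDerivAt (fun t : ℝ => fderiv ℝ u (x + t • e)) (fderiv ℝ (fderiv ℝ u) x e) 0 :=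
    h2.comp_hasDerivAt (0 : ℝ) (hline 0)
  have h4 : HasDerivAt (fun t : ℝ => fderiv ℝ u (x + t • e) e)
      (fderiv ℝ (fderiv ℝ u) x e e) 0 :=
    (ContinuousLinearMap.apply ℝ ℝ e).hasFDerivAt.comp_hasDerivAt 0 h3
  exact h4.deriv

/-- The necessary second-order condition at a local minimum, in one variable. -/
theorem IsLocalMin.deriv_deriv_nonneg {f : ℝ → ℝ} {a : ℝ} (h : IsLocalMin f a)
    (hc : ContinuousAt f a) : 0 ≤ deriv (deriv f) a := by
  by_contra! hneg
  have hmax : IsLocalMax f a := isLocalMax_of_deriv_deriv_neg hneg h.deriv_eq_zero hc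
  have hconst : f =ᶠ[𝓝 a] fun _ => f a := by
    filter_upwards [h, hmax] with t h₁ h₂ using le_antisymm h₂ h₁
  have := hconst.deriv.deriv_eq
  simp at this
  exact hneg.ne this

/-- The necessary second-order condition at a local minimum. -/
theorem IsLocalMin.iteratedFDeriv_two_nonneg {E : Type*} [NormedAddCommGroup E]
    [NormedSpace ℝ E] {u : E → ℝ} {x : E} (h : IsLocalMin u x) (hu : ContDiffAt ℝ 2 u x)
    (e : E) : 0 ≤ iteratedFDeriv ℝ 2 u x ![e, e] := by
  rw [← deriv_deriv_comp_line hu]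
  have hc : ContinuousAt (fun t : ℝ => x + t • e) 0 := by fun_prop
  have hx : x + (0 : ℝ) • e = x := by simp
  have ht : Tendsto (fun t : ℝ => x + t • e) (𝓝 0) (𝓝 x) := by simpa [ContinuousAt] using hc
  refine IsLocalMin.deriv_deriv_nonneg ?_ ?_
  · have := ht.eventually h
    simpa [IsLocalMin, IsMinFilter] using this
  · exact ContinuousAt.comp (f := fun t : ℝ => x + t • e) (g := u)
      (by rw [hx]; exact hu.continuousAt) hc

theorem contDiffAt_log_norm_sub_sub_sq {E : Type*} [NormedAddCommGroup E]
    [InnerProductSpace ℝ E] (c ε : ℝ) {x p : E} (y : E) (hp : x ≠ p) :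
    ContDiffAt ℝ 2 (fun x => c * Real.log ‖x - p‖ - ε * ‖x - y‖ ^ 2) x := by
  have hne : x - p ≠ 0 := sub_ne_zero.2 hp
  exact (contDiffAt_const.mul (((contDiffAt_id.sub contDiffAt_const).norm ℝ hne).log
    (norm_ne_zero_iff.2 hne))).sub
    (contDiffAt_const.mul ((contDiffAt_id.sub contDiffAt_const).norm_sq ℝ))

/-- Second derivatives of `c * log ‖x - p‖ - ε * ‖x - y‖ ^ 2` along the coordinate axes. -/
theorem iteratedFDeriv_two_log_norm_sub_sub_sq {d : ℕ} (c ε : ℝ)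
    {x p : EuclideanSpace ℝ (Fin d)} (y : EuclideanSpace ℝ (Fin d)) (hp : x ≠ p) (i : Fin d) :
    iteratedFDeriv ℝ 2 (fun x => c * Real.log ‖x - p‖ - ε * ‖x - y‖ ^ 2) x
      ![EuclideanSpace.single i 1, EuclideanSpace.single i 1] =
      c * ((‖x - p‖ ^ 2 - 2 * (x - p) i ^ 2) / ‖x - p‖ ^ 4) - 2 * ε := by
  rw [← deriv_deriv_comp_line (contDiffAt_log_norm_sub_sub_sq c ε y hp)]
  have hsq : ∀ (q : EuclideanSpace ℝ (Fin d)) (t : ℝ),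
      ‖x + t • EuclideanSpace.single i (1 : ℝ) - q‖ ^ 2 =
        ‖x - q‖ ^ 2 + 2 * (x - q) i * t + t ^ 2 := fun q t => by
    rw [show x + t • EuclideanSpace.single i (1 : ℝ) - q =
      (x - q) + t • EuclideanSpace.single i (1 : ℝ) by abel, norm_add_sq_real]
    simp [inner_smul_right, norm_smul, EuclideanSpace.inner_single_right]
    ring
  have hlog : ∀ t : ℝ, Real.log ‖x + t • EuclideanSpace.single i (1 : ℝ) - p‖ =
      (1 / 2) * Real.log (‖x - p‖ ^ 2 + 2 * (x - p) i * t + t ^ 2) := fun t => by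
    rw [← hsq, Real.log_pow]; push_cast; ring
  simp only [hlog, hsq]
  have hA : 0 < ‖x - p‖ := norm_pos_iff.2 (sub_ne_zero.2 hp)
  generalize ‖x - p‖ = A at *
  generalize (x - p) i = b at *
  generalize ‖x - y‖ = B at *
  generalize (x - y) i = b' at *
  have hpoly : ∀ A b t : ℝ, HasDerivAt (fun t : ℝ => A ^ 2 + 2 * b * t + t ^ 2)
      (2 * b + 2 * t) t := fun A b t => by
    have h₁ := ((hasDerivAt_id t).const_mul (2 * b)).const_add (A ^ 2)
    have h₂ := (hasDerivAt_id t).pow 2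
    refine (h₁.add h₂).congr_deriv ?_
    simp
  have hev : ∀ᶠ t in 𝓝 (0 : ℝ), A ^ 2 + 2 * b * t + t ^ 2 ≠ 0 := by
    refine (hpoly A b 0).continuousAt.eventually_ne ?_
    simp [hA.ne']
  have hd : deriv (fun t : ℝ => c * ((1 / 2) * Real.log (A ^ 2 + 2 * b * t + t ^ 2)) -
      ε * (B ^ 2 + 2 * b' * t + t ^ 2)) =ᶠ[𝓝 0] fun t =>
      c * ((1 / 2) * ((2 * b + 2 * t) / (A ^ 2 + 2 * b * t + t ^ 2))) -
      ε * (2 * b' + 2 * t) := by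
    filter_upwards [hev] with t ht
    exact (((((hpoly A b t).log ht).const_mul (1 / 2)).const_mul c).sub
      ((hpoly B b' t).const_mul ε)).deriv
  rw [hd.deriv_eq]
  have hlin : ∀ b : ℝ, HasDerivAt (fun t : ℝ => 2 * b + 2 * t) 2 0 := fun b => by
    simpa using ((hasDerivAt_id (0 : ℝ)).const_mul 2).const_add (2 * b)
  have h := ((((hlin b).div (hpoly A b 0) (by simp [hA.ne'])).const_mul (1 / 2)).const_mul c).sub
      ((hlin b').const_mul ε)
  refine h.deriv.trans ?_
  simp
  field_simp

/-- A planar harmonic function on a bounded open set that dominates `-c * log ‖x - p‖` on the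
frontier, where `p` is a point outside the closure, dominates it inside as well. -/
theorem IsHarmonicOn.neg_log_le {Ω : Set ℝ²} (hopen : IsOpen Ω) (hbd : Bornology.IsBounded Ω)
    {u : ℝ² → ℝ} (hu : IsHarmonicOn u Ω) (hcont : ContinuousOn u (closure Ω)) {c : ℝ} {p : ℝ²}
    (hp : p ∉ closure Ω) (hfr : ∀ x ∈ frontier Ω, -(c * Real.log ‖x - p‖) ≤ u x) {y : ℝ²}
    (hy : y ∈ Ω) : -(c * Real.log ‖y - p‖) ≤ u y := by
  have hcomp : IsCompact (closure Ω) := hbd.isCompact_closure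
  obtain ⟨D, hD⟩ := hcomp.isBounded.subset_closedBall y
  have hne : ∀ x ∈ closure Ω, x ≠ p := fun x hx h => hp (h ▸ hx)
  have key : ∀ ε > 0, -(c * Real.log ‖y - p‖) ≤ u y + ε * D ^ 2 := by
    intro ε hε
    have hψc : ContinuousOn (fun x => c * Real.log ‖x - p‖ - ε * ‖x - y‖ ^ 2) (closure Ω) := by
      refine (continuousOn_const.mul (ContinuousOn.log (by fun_prop) ?_)).sub (by fun_prop)
      intro x hx
      exact norm_ne_zero_iff.2 (sub_ne_zero.2 (hne x hx))
    obtain ⟨m, hm, hmin⟩ := hcomp.exists_isMinOn ⟨y, subset_closure hy⟩ (hcont.add hψc)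
    have hmΩ : m ∉ Ω := by
      intro hmΩ
      have hum : ContDiffAt ℝ 2 u m := hu.1.contDiffAt (hopen.mem_nhds hmΩ)
      have hψm := contDiffAt_log_norm_sub_sub_sq c ε y (hne m hm)
      have hloc := hmin.isLocalMin (mem_of_superset (hopen.mem_nhds hmΩ) subset_closure)
      have hnn := fun i : Fin 2 =>
        hloc.iteratedFDeriv_two_nonneg (hum.add hψm) (EuclideanSpace.single i 1)
      have hlap := hu.2 m hmΩ
      simp only [iteratedFDerivWithin_of_isOpen 2 hopen hmΩ, Fin.sum_univ_two] at hlap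
      rw [iteratedFDeriv_add_apply hum hψm] at hnn
      simp only [add_apply,
        iteratedFDeriv_two_log_norm_sub_sub_sq c ε y (hne m hm)] at hnn
      have h0 := hnn 0
      have h1 := hnn 1
      have hnorm : ‖m - p‖ ^ 2 = (m - p) 0 ^ 2 + (m - p) 1 ^ 2 := by
        rw [EuclideanSpace.real_norm_sq_eq, Fin.sum_univ_two]
      have hsum : c * ((‖m - p‖ ^ 2 - 2 * (m - p) 0 ^ 2) / ‖m - p‖ ^ 4) +
          c * ((‖m - p‖ ^ 2 - 2 * (m - p) 1 ^ 2) / ‖m - p‖ ^ 4) = 0 := by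
        rw [← mul_add, ← add_div, hnorm]
        ring
      linarith
    have hmfr : m ∈ frontier Ω := by
      rw [hopen.frontier_eq]; exact ⟨hm, hmΩ⟩
    have h₁ := hmin (subset_closure hy)
    have h₂ := hfr m hmfr
    have h₃ : ‖m - y‖ ≤ D := by simpa [dist_eq_norm] using hD hm
    have h₄ : ε * ‖m - y‖ ^ 2 ≤ ε * D ^ 2 := by gcongr
    simp at h₁
    linarith
  have hlim : Tendsto (fun ε : ℝ => u y + ε * D ^ 2) (𝓝[>] 0) (𝓝 (u y)) := by
    have : ContinuousAt (fun ε : ℝ => u y + ε * D ^ 2) 0 := by fun_prop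
    simpa using (this.tendsto.mono_left nhdsWithin_le_nhds)
  exact ge_of_tendsto hlim (eventually_mem_nhdsWithin.mono key)

/-- The mirror image of an interior point `y` of a convex open set in a supporting hyperplane
at a point `z` outside of the set. -/
theorem Convex.exists_reflection {E : Type*} [NormedAddCommGroup E] [InnerProductSpace ℝ E]
    [CompleteSpace E] {Ω : Set E} (hconv : Convex ℝ Ω) (hopen : IsOpen Ω) {y z : E} (hy : y ∈ Ω)
    (hz : z ∉ Ω) : ∃ p ∉ closure Ω, ‖y - p‖ ≤ 2 * ‖y - z‖ ∧
      ∀ x ∈ closure Ω, ‖x - y‖ ≤ ‖x - p‖ := by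
  obtain ⟨f, hf⟩ := geometric_hahn_banach_open_point hconv hopen hz
  have hcl : ∀ x ∈ closure Ω, f x ≤ f z := fun x hx =>
    closure_minimal (fun a ha => (hf a ha).le) (isClosed_le f.continuous continuous_const) hx
  set n : E := (toDual ℝ E).symm f with hn
  have hfn : ∀ x, f x = ⟪n, x⟫_ℝ := fun x => by simp [hn]
  have hfy := hf y hy
  have hn0 : n ≠ 0 := by
    intro h
    simp [hfn, h] at hfy
  have hN : 0 < ‖n‖ := norm_pos_iff.2 hn0
  set s : ℝ := 2 * (f z - f y) / ‖n‖ ^ 2 with hs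
  have hs0 : 0 < s := by
    have : 0 < f z - f y := sub_pos.2 hfy
    positivity
  have hsN : s * ‖n‖ ^ 2 = 2 * (f z - f y) := by
    rw [hs]; field_simp
  refine ⟨y + s • n, fun hmem => ?_, ?_, fun x hx => ?_⟩
  · have := hcl _ hmem
    rw [map_add, map_smul, hfn n, real_inner_self_eq_norm_sq, smul_eq_mul, hsN] at this
    linarith
  · have h₁ : f z - f y ≤ ‖n‖ * ‖y - z‖ := by
      rw [← map_sub, hfn, norm_sub_rev]
      exact real_inner_le_norm _ _
    rw [sub_add_cancel_left, norm_neg, norm_smul, Real.norm_of_nonneg hs0.le]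
    refine le_of_mul_le_mul_right ?_ hN
    nlinarith
  · rw [← sq_le_sq₀ (norm_nonneg _) (norm_nonneg _), ← sub_sub, norm_sub_sq_real (x - y) (s • n),
      inner_smul_right, real_inner_comm, ← hfn, map_sub, norm_smul, Real.norm_of_nonneg hs0.le]
    have := hcl x hx
    nlinarith

/-- **Lower bound for the Dirichlet Robin function, `d = 2`.**
If `g(·,y)` is the regular part of the Dirichlet Green function of a nonempty open bounded
convex set `Ω ⊆ ℝ²` (harmonic in `x`, continuous up to the closure, equal to `−G` on the
frontier), then there are `c₁, c₂ > 0` with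
`g(x,x) ≥ −c₂·ln dist(x,∂Ω) − c₁` for all `x ∈ Ω`. -/
theorem stmt4 (Ω : Set (EuclideanSpace ℝ (Fin 2)))
    (hopen : IsOpen Ω) (hbd : Bornology.IsBounded Ω) (hconv : Convex ℝ Ω) (hne : Ω.Nonempty)
    (g : EuclideanSpace ℝ (Fin 2) → EuclideanSpace ℝ (Fin 2) → ℝ)
    (hharm : ∀ y ∈ Ω, IsHarmonicOn (fun x => g x y) Ω)
    (hcont : ∀ y ∈ Ω, ContinuousOn (fun x => g x y) (closure Ω))
    (hbdry : ∀ y ∈ Ω, ∀ x ∈ frontier Ω, g x y = -fundSol2 x y) :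
    ∃ c₁ > 0, ∃ c₂ > 0, ∀ x ∈ Ω,
      -c₂ * Real.log (Metric.infDist x (frontier Ω)) - c₁ ≤ g x x := by
  have hfrne : (frontier Ω).Nonempty :=
    nonempty_frontier_iff.2 ⟨hne, fun h => NormedSpace.unbounded_univ ℝ ℝ² (h ▸ hbd)⟩
  have hc : 0 < 1 / (2 * Real.pi) := by positivity
  refine ⟨1 / (2 * Real.pi) * Real.log 2, mul_pos hc (Real.log_pos one_lt_two),
    1 / (2 * Real.pi), hc, fun y hy => ?_⟩
  obtain ⟨z, hz, hd⟩ := isClosed_frontier.exists_infDist_eq_dist hfrne y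
  have hzΩ : z ∉ Ω := (hopen.frontier_eq ▸ hz : z ∈ closure Ω \ Ω).2
  obtain ⟨p, hp, hyp, hxp⟩ := hconv.exists_reflection hopen hy hzΩ
  have hmain : -(1 / (2 * Real.pi) * Real.log ‖y - p‖) ≤ g y y := by
    refine (hharm y hy).neg_log_le hopen hbd (hcont y hy) hp (fun x hx => ?_) hy
    have hxy : 0 < ‖x - y‖ := by
      refine norm_pos_iff.2 (sub_ne_zero.2 ?_)
      rintro rfl
      exact (hopen.frontier_eq ▸ hx : x ∈ closure Ω \ Ω).2 hy
    rw [hbdry y hy x hx, fundSol2]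
    have := Real.log_le_log hxy (hxp x (frontier_subset_closure hx))
    gcongr
  have hyp0 : 0 < ‖y - p‖ :=
    norm_pos_iff.2 (sub_ne_zero.2 fun h => hp (h ▸ subset_closure hy))
  have hdz : 0 < ‖y - z‖ := by linarith
  have hlog : Real.log ‖y - p‖ ≤ Real.log 2 + Real.log ‖y - z‖ := by
    rw [← Real.log_mul two_ne_zero hdz.ne']
    exact Real.log_le_log hyp0 hyp
  rw [hd, dist_eq_norm]
  have := mul_le_mul_of_nonneg_left hlog hc.le
  linarith
end

section
/- Let Ω ⊆ ℝ² be a nonempty open bounded convex set whose boundary is of class C⁴, in the sense that for every p ∈ ∂Ω there exist an open neighborhood U of p and a four-times continuously differentiable function Φ : U → ℝ with ∇Φ(z) ≠ 0 for all z ∈ U, Ω ∩ U = {z ∈ U : Φ(z) < 0} and ∂Ω ∩ U = {z ∈ U : Φ(z) = 0}. Let n : ∂Ω → ℝ² satisfy ‖n(x)‖ = 1 and ⟪w − x, n(x)⟫ ≤ 0 for all x ∈ ∂Ω and w ∈ Ω. Set G(x,y) = (1/(2π))·ln‖x − y‖ for x ≠ y. Suppose q : cl(Ω) × Ω → ℝ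 satisfies: (a) q(x,y) = q(y,x) for all x, y ∈ Ω; (b) for every y ∈ Ω, x ↦ q(x,y) is twice continuously differentiable on Ω with Δ_x q(x,y) = −1/vol(Ω) for all x ∈ Ω, where vol(Ω) is the Lebesgue measure of Ω, and both q(·,y) and ∇_x q(·,y) extend continuously to cl(Ω); (c) for every y ∈ Ω and every x ∈ ∂Ω, ⟪∇_x G(x,y) + ∇_x q(x,y), n(x)⟫ = 0. Then there exist constants c₁, c₂ > 0 such that q(x,x) ≤ c₁ + c₂ · ln dist(x, ∂Ω) for every x ∈ Ω. -/
open scoped BigOperators RealInnerProductSpace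

/-- `Ω` has boundary of class `C⁴`: near each boundary point there is a four-times
continuously differentiable local defining function with nonvanishing derivative. -/
def IsC4Boundary {d : ℕ} (Ω : Set (EuclideanSpace ℝ (Fin d))) : Prop :=
  ∀ p ∈ frontier Ω, ∃ (U : Set (EuclideanSpace ℝ (Fin d))) (Φ : EuclideanSpace ℝ (Fin d) → ℝ),
    IsOpen U ∧ p ∈ U ∧ ContDiffOn ℝ 4 Φ U ∧ (∀ z ∈ U, fderivWithin ℝ Φ U z ≠ 0) ∧
    Ω ∩ U = {z ∈ U | Φ z < 0} ∧ frontier Ω ∩ U = {z ∈ U | Φ z = 0}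

open Filter Topology Set

section Calculus

variable {F : Type*} [NormedAddCommGroup F] [InnerProductSpace ℝ F]

lemma secondDeriv_nonpos_of_isLocalMax {g g' : ℝ → ℝ} {a c : ℝ} (hmax : IsLocalMax g a)
    (hg : ∀ᶠ t in 𝓝 a, HasDerivAt g (g' t) t) (hg' : HasDerivAt g' c a) : c ≤ 0 := by
  by_contra! hc
  have hd : deriv g =ᶠ[𝓝 a] g' := hg.mono fun t ht => ht.deriv
  have hdd : deriv (deriv g) a = c := by rw [hd.deriv_eq, hg'.deriv]
  have hmin : IsLocalMin g a := isLocalMin_of_deriv_deriv_pos (by rwa [hdd]) hmax.deriv_eq_zero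
    hg.self_of_nhds.continuousAt
  have hconst : g =ᶠ[𝓝 a] fun _ => g a := by
    filter_upwards [hmax, hmin] with t h₁ h₂ using le_antisymm h₁ h₂
  have hzero : deriv (deriv g) a = 0 := by
    rw [hconst.deriv.deriv_eq]
    simp
  linarith

lemma eventually_lt_of_tendsto_deriv_pos {g g' : ℝ → ℝ} {a c : ℝ}
    (hcont : ContinuousWithinAt g (Ici a) a)
    (hg : ∀ᶠ t in 𝓝[>] a, HasDerivAt g (g' t) t) (hg' : Tendsto g' (𝓝[>] a) (𝓝 c))
    (hc : 0 < c) : ∀ᶠ t in 𝓝[>] a, g a < g t := by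
  obtain ⟨b, hab, hb⟩ := mem_nhdsGT_iff_exists_Ioo_subset.1
    (hg.and (hg'.eventually (eventually_gt_nhds hc)))
  have hmono : StrictMonoOn g (Ico a b) := by
    refine strictMonoOn_of_deriv_pos (convex_Ico a b) (fun t ht => ?_) (fun t ht => ?_)
    · rcases eq_or_lt_of_le ht.1 with rfl | hat
      · exact hcont.mono Ico_subset_Ici_self
      · exact (hb ⟨hat, ht.2⟩).1.continuousAt.continuousWithinAt
    · rw [interior_Ico] at ht
      rw [(hb ht).1.deriv]
      exact (hb ht).2
  filter_upwards [Ioo_mem_nhdsGT hab] with t ht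
  exact hmono ⟨le_rfl, hab⟩ ⟨ht.1.le, ht.2⟩ ht.1

lemma hasDerivAt_line (x e a : F) (t : ℝ) : HasDerivAt (fun s : ℝ => x + s • e - a) e t := by
  simpa using (((hasDerivAt_id t).smul_const e).const_add x).sub_const a

lemma hasDerivAt_inner_line (x e a : F) (t : ℝ) :
    HasDerivAt (fun s : ℝ => ⟪x + s • e - a, e⟫) (‖e‖ ^ 2) t := by
  simpa using (hasDerivAt_line x e a t).inner ℝ (hasDerivAt_const t e)

lemma hasDerivAt_log_norm_line {x e a : F} {t : ℝ} (h : x + t • e ≠ a) :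
    HasDerivAt (fun s : ℝ => Real.log ‖x + s • e - a‖)
      (⟪x + t • e - a, e⟫ / ‖x + t • e - a‖ ^ 2) t := by
  have hne : ‖x + t • e - a‖ ≠ 0 := by simpa [sub_eq_zero] using h
  have hlog := (((hasDerivAt_line x e a t).norm_sq).log (pow_ne_zero 2 hne)).div_const 2
  simp only [Real.log_pow] at hlog
  refine (hlog.congr_deriv ?_).congr_of_eventuallyEq (Eventually.of_forall fun s => ?_)
  · ring
  · push_cast
    ring

lemma hasDerivAt_deriv_log_norm_line {x e a : F} {t : ℝ} (h : x + t • e ≠ a) :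
    HasDerivAt (fun s : ℝ => ⟪x + s • e - a, e⟫ / ‖x + s • e - a‖ ^ 2)
      (‖e‖ ^ 2 / ‖x + t • e - a‖ ^ 2
        - 2 * ⟪x + t • e - a, e⟫ ^ 2 / ‖x + t • e - a‖ ^ 4) t := by
  have hne : ‖x + t • e - a‖ ≠ 0 := by simpa [sub_eq_zero] using h
  refine ((hasDerivAt_inner_line x e a t).div ((hasDerivAt_line x e a t).norm_sq)
    (pow_ne_zero 2 hne)).congr_deriv ?_
  field_simp

lemma hasDerivAt_inv_norm_sq_line {x e a : F} {t : ℝ} (h : x + t • e ≠ a) :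
    HasDerivAt (fun s : ℝ => (‖x + s • e - a‖ ^ 2)⁻¹)
      (-2 * ⟪x + t • e - a, e⟫ / ‖x + t • e - a‖ ^ 4) t := by
  have hne : ‖x + t • e - a‖ ≠ 0 := by simpa [sub_eq_zero] using h
  refine (((hasDerivAt_line x e a t).norm_sq).inv (pow_ne_zero 2 hne)).congr_deriv ?_
  field_simp

lemma hasDerivAt_deriv_inv_norm_sq_line {x e a : F} {t : ℝ} (h : x + t • e ≠ a) :
    HasDerivAt (fun s : ℝ => -2 * ⟪x + s • e - a, e⟫ / ‖x + s • e - a‖ ^ 4)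
      (-2 * ‖e‖ ^ 2 / ‖x + t • e - a‖ ^ 4
        + 8 * ⟪x + t • e - a, e⟫ ^ 2 / ‖x + t • e - a‖ ^ 6) t := by
  have hne : ‖x + t • e - a‖ ≠ 0 := by simpa [sub_eq_zero] using h
  have hpow := ((hasDerivAt_line x e a t).norm_sq).pow 2
  simp only [Pi.pow_def, ← pow_mul] at hpow
  refine (((hasDerivAt_inner_line x e a t).const_mul (-2)).div hpow
    (pow_ne_zero 4 hne)).congr_deriv ?_
  field_simp
  ring

lemma HasFDerivAt.hasDerivAt_line {f : F → ℝ} {f' : F →L[ℝ] ℝ} {x e : F} {t : ℝ}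
    (hf : HasFDerivAt f f' (x + t • e)) : HasDerivAt (fun s : ℝ => f (x + s • e)) (f' e) t := by
  have := _root_.hasDerivAt_line x e 0 t
  simp only [sub_zero] at this
  exact hf.comp_hasDerivAt t this

/-- The second derivative of a `C²` function along a line. -/
lemma ContDiffAt.hasDerivAt_fderiv_line {f : F → ℝ} {x : F} (hf : ContDiffAt ℝ 2 f x) (e : F) :
    HasDerivAt (fun s : ℝ => fderiv ℝ f (x + s • e) e) (iteratedFDeriv ℝ 2 f x ![e, e]) 0 := by
  have hdiff : DifferentiableAt ℝ (fderiv ℝ f) x :=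
    (hf.fderiv_right (m := 1) (by norm_num)).differentiableAt (by norm_num)
  have hf' : HasFDerivAt (fun z => fderiv ℝ f z e)
      ((ContinuousLinearMap.apply ℝ ℝ e).comp (fderiv ℝ (fderiv ℝ f) x)) (x + (0 : ℝ) • e) := by
    rw [zero_smul, add_zero]
    exact (ContinuousLinearMap.apply ℝ ℝ e).hasFDerivAt.comp x hdiff.hasFDerivAt
  refine hf'.hasDerivAt_line.congr_deriv ?_
  simp [iteratedFDeriv_two_apply]

lemma inner_gradient_log_norm {x a : F} [CompleteSpace F] (h : x ≠ a) (c : ℝ) (v : F) :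
    ⟪gradient (fun z => c * Real.log ‖z - a‖) x, v⟫ = c * (⟪x - a, v⟫ / ‖x - a‖ ^ 2) := by
  have hne : x - a ≠ 0 := sub_ne_zero.2 h
  have hd : DifferentiableAt ℝ (fun z => c * Real.log ‖z - a‖) x := by
    have hnorm : DifferentiableAt ℝ (fun z => ‖z - a‖) x :=
      (differentiableAt_id.sub_const a).norm ℝ hne
    exact (hnorm.log (norm_ne_zero_iff.2 hne)).const_mul c
  rw [← hd.hasGradientAt.fderiv_apply]
  have hfd : HasFDerivAt (fun z => c * Real.log ‖z - a‖)
      (fderiv ℝ (fun z => c * Real.log ‖z - a‖) x) (x + (0 : ℝ) • v) := by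
    simpa using hd.hasFDerivAt
  have hx : x + (0 : ℝ) • v ≠ a := by simpa using h
  have := hfd.hasDerivAt_line.unique ((hasDerivAt_log_norm_line hx).const_mul c)
  simpa using this

end Calculus

section Convex

variable {F : Type*} [NormedAddCommGroup F] [InnerProductSpace ℝ F]

lemma inner_nonpos_of_mem_closure {Ω : Set F} {x ν w : F} (h : ∀ w ∈ Ω, ⟪w - x, ν⟫ ≤ 0)
    (hw : w ∈ closure Ω) : ⟪w - x, ν⟫ ≤ 0 := by
  have hcl : IsClosed {w : F | ⟪w - x, ν⟫ ≤ 0} :=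
    isClosed_le (by fun_prop) continuous_const
  exact closure_minimal h hcl hw

lemma le_inner_of_ball_subset {Ω : Set F} {x y ν : F} {r : ℝ} (hν : ‖ν‖ = 1)
    (h : ∀ w ∈ Ω, ⟪w - x, ν⟫ ≤ 0) (hr : 0 < r) (hball : Metric.ball y r ⊆ Ω) :
    r ≤ ⟪x - y, ν⟫ := by
  refine le_of_forall_lt_imp_le_of_dense fun t ht => ?_
  by_cases ht0 : 0 ≤ t
  · have hmem : y + t • ν ∈ Ω := hball (by simp [norm_smul, hν, abs_of_nonneg ht0, ht])
    have := h _ hmem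
    have heq : y + t • ν - x = t • ν - (x - y) := by abel
    rw [heq, inner_sub_left, real_inner_smul_left, real_inner_self_eq_norm_sq, hν] at this
    linarith
  · have := h y (hball (Metric.mem_ball_self hr))
    have heq : y - x = -(x - y) := by abel
    rw [heq, inner_neg_left] at this
    linarith

lemma ball_infDist_frontier_subset {Ω : Set F} (hΩ : IsOpen Ω) {y : F} (hy : y ∈ Ω) :
    Metric.ball y (Metric.infDist y (frontier Ω)) ⊆ Ω := by
  rcases le_or_gt (Metric.infDist y (frontier Ω)) 0 with h | h
  · simp [Metric.ball_eq_empty.2 h]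
  refine IsPreconnected.subset_left_of_subset_union hΩ isClosed_closure.isOpen_compl
    (disjoint_compl_right_iff_subset.2 subset_closure) (fun z hz => ?_)
    ⟨y, Metric.mem_ball_self h, hy⟩ (convex_ball y _).isPreconnected
  by_contra hcon
  simp only [mem_union, mem_compl_iff, not_or, not_not] at hcon
  have hfr : z ∈ frontier Ω := by
    rw [hΩ.frontier_eq]
    exact ⟨hcon.2, hcon.1⟩
  have := Metric.infDist_le_dist_of_mem (x := y) hfr
  rw [Metric.mem_ball, dist_comm] at hz
  linarith

lemma eventually_sub_normal_mem_of_defining_function {Ω U : Set F} {Φ : F → ℝ}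
    {Φ' : F →L[ℝ] ℝ} {x ν : F}
    (hU : U ∈ 𝓝 x) (hΦ : HasFDerivAt Φ Φ' x) (hΦ' : Φ' ≠ 0) (hΦx : Φ x = 0)
    (hΩ : ∀ z ∈ U, Φ z < 0 → z ∈ Ω) (hν : ‖ν‖ = 1) (h : ∀ w ∈ Ω, ⟪w - x, ν⟫ ≤ 0) :
    ∀ᶠ t : ℝ in 𝓝[>] 0, x + t • (-ν) ∈ Ω := by
  have key : ∀ v : F, Φ' v < 0 → ∀ᶠ t : ℝ in 𝓝[>] 0, x + t • v ∈ Ω := by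
    intro v hv
    have hd : HasDerivAt (fun s : ℝ => -Φ (x + s • v)) (-Φ' v) 0 := by
      refine (HasFDerivAt.hasDerivAt_line ?_).neg
      simpa using hΦ
    have hlt : ∀ᶠ t : ℝ in 𝓝[>] 0, -Φ (x + (0 : ℝ) • v) < -Φ (x + t • v) := by
      have hs := hasDerivAt_iff_tendsto_slope.1 hd
      have hs' := (hs.mono_left (nhdsGT_le_nhdsNE 0)).eventually
        (eventually_gt_nhds (neg_pos.2 hv))
      filter_upwards [hs', self_mem_nhdsWithin] with t ht ht0
      rw [slope_def_field, sub_zero, div_pos_iff_of_pos_right ht0] at ht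
      exact sub_pos.1 ht
    have hcont : Tendsto (fun t : ℝ => x + t • v) (𝓝[>] 0) (𝓝 x) := by
      have : Continuous fun t : ℝ => x + t • v := by fun_prop
      simpa using (this.tendsto 0).mono_left nhdsWithin_le_nhds
    filter_upwards [hlt, hcont hU] with t ht htU
    refine hΩ _ htU ?_
    simp only [zero_smul, add_zero, hΦx] at ht
    linarith
  refine key _ ?_
  rw [map_neg, neg_lt_zero]
  by_contra! hle
  obtain ⟨v, hv⟩ : ∃ v, Φ' v < 0 := by
    by_contra! hall
    refine hΦ' (ContinuousLinearMap.ext fun v => le_antisymm ?_ (hall v))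
    have := hall (-v)
    rw [map_neg] at this
    simpa using this
  have hpos : 0 < (‖v‖ + 1) := by positivity
  set ε : ℝ := (‖v‖ + 1)⁻¹
  have hε : 0 < ε := by positivity
  have hneg : Φ' (ν + ε • v) < 0 := by
    rw [map_add, map_smul, smul_eq_mul]
    nlinarith
  obtain ⟨t, htΩ, ht⟩ := ((key _ hneg).and self_mem_nhdsWithin).exists
  have h1 := h _ htΩ
  rw [add_sub_cancel_left, real_inner_smul_left] at h1
  have h2 : ⟪ν + ε • v, ν⟫ ≤ 0 := nonpos_of_mul_nonpos_right h1 ht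
  rw [inner_add_left, real_inner_smul_left, real_inner_self_eq_norm_sq, hν] at h2
  have h3 : -‖v‖ ≤ ⟪v, ν⟫ := by
    have := neg_le_of_abs_le (abs_real_inner_le_norm v ν)
    rwa [hν, mul_one] at this
  have h4 : ε * ‖v‖ < 1 := by
    rw [inv_mul_lt_iff₀ hpos]
    linarith
  nlinarith

end Convex

lemma exists_closedBall_forall_le {F : Type*} [NormedAddCommGroup F] [CompleteSpace F]
    {Ω : Set F} (hΩ : IsOpen Ω) (hne : Ω.Nonempty) {ι : Type*} {S : Set ι} {f : F → ι → ℝ}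
    (hcont : ∀ i ∈ S, ContinuousOn (fun x => f x i) Ω)
    (hb : ∀ x ∈ Ω, ∃ M, ∀ i ∈ S, f x i ≤ M) :
    ∃ z r k, 0 < r ∧ Metric.closedBall z r ⊆ Ω ∧
      ∀ x ∈ Metric.closedBall z r, ∀ i ∈ S, f x i ≤ k := by
  have : BaireSpace Ω := hΩ.baireSpace
  have : Nonempty Ω := hne.to_subtype
  have hclosed : ∀ k : ℕ, IsClosed {x : Ω | ∀ i ∈ S, f x i ≤ k} := by
    intro k
    simp only [ofPred_forall]
    refine isClosed_biInter fun i hi => isClosed_le ?_ continuous_const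
    exact continuousOn_iff_continuous_domRestrict.1 (hcont i hi)
  have hunion : ⋃ k : ℕ, {x : Ω | ∀ i ∈ S, f x i ≤ k} = univ := by
    refine eq_univ_of_forall fun x => mem_iUnion.2 ?_
    obtain ⟨M, hM⟩ := hb x x.2
    obtain ⟨k, hk⟩ := exists_nat_ge M
    exact ⟨k, fun i hi => (hM i hi).trans hk⟩
  obtain ⟨k, x, hx⟩ := nonempty_interior_of_iUnion_of_closed hclosed hunion
  have himg : IsOpen (Set.image Subtype.val (interior {x : Ω | ∀ i ∈ S, f x i ≤ k})) :=
    hΩ.isOpenMap_subtype_val _ isOpen_interior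
  obtain ⟨r, hr, hsub⟩ := Metric.nhds_basis_closedBall.mem_iff.1
    (himg.mem_nhds (mem_image_of_mem _ hx))
  refine ⟨x, r, k, hr, fun z hz => ?_, fun z hz => ?_⟩
  · obtain ⟨w, -, rfl⟩ := hsub hz
    exact w.2
  · obtain ⟨w, hw, rfl⟩ := hsub hz
    exact interior_subset hw

lemma IsC4Boundary.eventually_sub_normal_mem {d : ℕ} {Ω : Set (EuclideanSpace ℝ (Fin d))}
    (hC4 : IsC4Boundary Ω) {x ν : EuclideanSpace ℝ (Fin d)} (hx : x ∈ frontier Ω)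
    (hν : ‖ν‖ = 1) (h : ∀ w ∈ Ω, ⟪w - x, ν⟫ ≤ 0) :
    ∀ᶠ t : ℝ in 𝓝[>] 0, x + t • (-ν) ∈ Ω := by
  obtain ⟨U, Φ, hU, hxU, hΦ, hΦ', hΩU, hfrU⟩ := hC4 x hx
  have hUx : U ∈ 𝓝 x := hU.mem_nhds hxU
  have hdiff : DifferentiableAt ℝ Φ x := (hΦ.contDiffAt hUx).differentiableAt (by norm_num)
  refine eventually_sub_normal_mem_of_defining_function hUx hdiff.hasFDerivAt ?_
    (hfrU.subset ⟨hx, hxU⟩).2 (fun z hzU hz => (hΩU.superset ⟨hzU, hz⟩).1) hν h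
  rw [← fderivWithin_of_isOpen hU hxU]
  exact hΦ' x hxU

/-- The function `u` minus a logarithmic pole at `a` plus an inverse square pole at `b`. -/
noncomputable def polarComparison (u : EuclideanSpace ℝ (Fin 2) → ℝ) (c K : ℝ)
    (a b x : EuclideanSpace ℝ (Fin 2)) : ℝ :=
  u x - c * Real.log ‖x - a‖ + K * (‖x - b‖ ^ 2)⁻¹

section PolarComparison

variable {u : EuclideanSpace ℝ (Fin 2) → ℝ} {c K : ℝ} {a b x : EuclideanSpace ℝ (Fin 2)}

lemma hasDerivAt_polarComparison_line {e : EuclideanSpace ℝ (Fin 2)} {t u' : ℝ}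
    (hu : HasDerivAt (fun s : ℝ => u (x + s • e)) u' t) (ha : x + t • e ≠ a)
    (hb : x + t • e ≠ b) :
    HasDerivAt (fun s : ℝ => polarComparison u c K a b (x + s • e))
      (u' - c * (⟪x + t • e - a, e⟫ / ‖x + t • e - a‖ ^ 2)
        + K * (-2 * ⟪x + t • e - b, e⟫ / ‖x + t • e - b‖ ^ 4)) t :=
  (hu.sub ((hasDerivAt_log_norm_line ha).const_mul c)).add
    ((hasDerivAt_inv_norm_sq_line hb).const_mul K)

lemma ContinuousOn.polarComparison {s : Set (EuclideanSpace ℝ (Fin 2))} (hu : ContinuousOn u s)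
    (ha : a ∉ s) (hb : b ∉ s) : ContinuousOn (polarComparison u c K a b) s := by
  refine (hu.sub (continuousOn_const.mul (ContinuousOn.log (by fun_prop) fun x hx => ?_))).add
    (continuousOn_const.mul (ContinuousOn.inv₀ (by fun_prop) fun x hx => ?_))
  · rw [norm_ne_zero_iff, sub_ne_zero]
    rintro rfl
    exact ha hx
  · rw [pow_ne_zero_iff two_ne_zero, norm_ne_zero_iff, sub_ne_zero]
    rintro rfl
    exact hb hx

/-- At a local maximum the Laplacian of `polarComparison u c K a b` is nonpositive. -/
lemma laplacian_add_le_zero_of_isLocalMax_polarComparison (hu : ContDiffAt ℝ 2 u x)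
    (ha : x ≠ a) (hb : x ≠ b) (hmax : IsLocalMax (polarComparison u c K a b) x) :
    ∑ i : Fin 2, iteratedFDeriv ℝ 2 u x ![EuclideanSpace.single i 1, EuclideanSpace.single i 1]
      + 4 * K / ‖x - b‖ ^ 4 ≤ 0 := by
  have hdir : ∀ i : Fin 2,
      iteratedFDeriv ℝ 2 u x ![EuclideanSpace.single i 1, EuclideanSpace.single i 1]
        - c * (1 / ‖x - a‖ ^ 2 - 2 * (x - a) i ^ 2 / ‖x - a‖ ^ 4)
        + K * (-2 / ‖x - b‖ ^ 4 + 8 * (x - b) i ^ 2 / ‖x - b‖ ^ 6) ≤ 0 := by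
    intro i
    set e : EuclideanSpace ℝ (Fin 2) := EuclideanSpace.single i 1 with he
    have hline : ContinuousAt (fun t : ℝ => x + t • e) 0 := by fun_prop
    have hline' : Tendsto (fun t : ℝ => x + t • e) (𝓝 0) (𝓝 x) := by
      simpa [ContinuousAt] using hline
    have hx0 : x + (0 : ℝ) • e = x := by simp
    have hmax' : IsLocalMax (fun t : ℝ => polarComparison u c K a b (x + t • e)) 0 := by
      have := hline'.eventually hmax
      simpa [IsLocalMax, IsMaxFilter] using this
    have h1 : ∀ᶠ t : ℝ in 𝓝 0, HasDerivAt (fun s : ℝ => polarComparison u c K a b (x + s • e))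
        (fderiv ℝ u (x + t • e) e - c * (⟪x + t • e - a, e⟫ / ‖x + t • e - a‖ ^ 2)
        + K * (-2 * ⟪x + t • e - b, e⟫ / ‖x + t • e - b‖ ^ 4)) t := by
      filter_upwards [hline'.eventually (hu.eventually (by simp)),
        hline'.eventually (eventually_ne_nhds ha), hline'.eventually (eventually_ne_nhds hb)]
        with t htu hta htb
      exact hasDerivAt_polarComparison_line
        (htu.differentiableAt (by norm_num)).hasFDerivAt.hasDerivAt_line hta htb
    have h2 := ((hu.hasDerivAt_fderiv_line e).sub
      ((hasDerivAt_deriv_log_norm_line (hx0.trans_ne ha)).const_mul c)).add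
      ((hasDerivAt_deriv_inv_norm_sq_line (hx0.trans_ne hb)).const_mul K)
    have h3 := secondDeriv_nonpos_of_isLocalMax hmax' h1 h2
    have hin : ∀ v : EuclideanSpace ℝ (Fin 2), ⟪v, e⟫ = v i := by
      intro v
      simp [he, EuclideanSpace.inner_single_right]
    have hne : ‖e‖ = 1 := by simp [he]
    simpa only [hx0, hin, hne, one_pow, mul_one] using h3
  have hsum := Finset.sum_nonpos fun i (_ : i ∈ Finset.univ) => hdir i
  have hna : ‖x - a‖ ≠ 0 := norm_ne_zero_iff.2 (sub_ne_zero.2 ha)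
  have hnb : ‖x - b‖ ≠ 0 := norm_ne_zero_iff.2 (sub_ne_zero.2 hb)
  have hsq : ∀ v : EuclideanSpace ℝ (Fin 2), v 1 ^ 2 = ‖v‖ ^ 2 - v 0 ^ 2 := by
    intro v
    simp [EuclideanSpace.norm_sq_eq, Fin.sum_univ_two]
  rw [Fin.sum_univ_two, hsq, hsq] at hsum
  rw [Fin.sum_univ_two]
  refine le_of_eq_of_le ?_ hsum
  field_simp
  ring

/-- Maximum principle on a domain with a ball removed: if `polarComparison u c K a b` is strictly
subharmonic and its outward normal derivative is negative, then it is controlled by its values on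
the sphere around `b`. -/
lemma exists_sphere_polarComparison_le {Ω : Set (EuclideanSpace ℝ (Fin 2))} (hopen : IsOpen Ω)
    (hbd : Bornology.IsBounded Ω) {n Du : EuclideanSpace ℝ (Fin 2) → EuclideanSpace ℝ (Fin 2)}
    (hin : ∀ x ∈ frontier Ω, ∀ᶠ t : ℝ in 𝓝[>] 0, x + t • (-n x) ∈ Ω)
    (hsmooth : ContDiffOn ℝ 2 u Ω) (hgrad : ∀ x ∈ Ω, HasGradientAt u (Du x) x)
    (hucont : ContinuousOn u (closure Ω)) (hDucont : ContinuousOn Du (closure Ω))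
    {r : ℝ} (hr : 0 < r) (ha : a ∉ closure Ω)
    (hlap : ∀ x ∈ Ω, x ≠ b → 0 < ∑ i : Fin 2,
      iteratedFDeriv ℝ 2 u x ![EuclideanSpace.single i 1, EuclideanSpace.single i 1]
        + 4 * K / ‖x - b‖ ^ 4)
    (hbdry : ∀ x ∈ frontier Ω, ⟪Du x, n x⟫ - c * (⟪x - a, n x⟫ / ‖x - a‖ ^ 2)
        + K * (-2 * ⟪x - b, n x⟫ / ‖x - b‖ ^ 4) < 0)
    {y : EuclideanSpace ℝ (Fin 2)} (hy : y ∈ Ω) (hyb : r ≤ dist y b) :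
    ∃ z ∈ Metric.sphere b r, polarComparison u c K a b y ≤ polarComparison u c K a b z := by
  have hbA : b ∉ closure Ω \ Metric.ball b r := fun h => h.2 (Metric.mem_ball_self hr)
  have hcompact : IsCompact (closure Ω \ Metric.ball b r) :=
    hbd.isCompact_closure.diff Metric.isOpen_ball
  have hcont : ContinuousOn (polarComparison u c K a b) (closure Ω \ Metric.ball b r) :=
    (hucont.mono sdiff_subset).polarComparison (fun h => ha h.1) hbA
  obtain ⟨x, hxA, hxmax⟩ := hcompact.exists_isMaxOn
    ⟨y, subset_closure hy, by simpa using hyb⟩ hcont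
  refine ⟨x, ?_, hxmax ⟨subset_closure hy, by simpa using hyb⟩⟩
  have hxr : r ≤ dist x b := by simpa using hxA.2
  by_contra hxs
  have hxgt : r < dist x b := lt_of_le_of_ne hxr fun h => hxs h.symm
  have hxa : x ≠ a := by
    rintro rfl
    exact ha hxA.1
  have hxb : x ≠ b := dist_pos.1 (hr.trans hxgt)
  have hfar : ∀ᶠ z in 𝓝 x, r < dist z b :=
    (continuous_id.dist continuous_const).continuousAt.eventually (eventually_gt_nhds hxgt)
  by_cases hxΩ : x ∈ Ω
  · have hmax : IsLocalMax (polarComparison u c K a b) x := by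
      filter_upwards [hfar, hopen.mem_nhds hxΩ] with z hz hzΩ
      exact hxmax ⟨subset_closure hzΩ, by simpa using hz.le⟩
    have := laplacian_add_le_zero_of_isLocalMax_polarComparison
      (hsmooth.contDiffAt (hopen.mem_nhds hxΩ)) hxa hxb hmax
    linarith [hlap x hxΩ hxb]
  · have hfr : x ∈ frontier Ω := by
      rw [hopen.frontier_eq]
      exact ⟨hxA.1, hxΩ⟩
    obtain ⟨e, he⟩ : ∃ e, e = -n x := ⟨_, rfl⟩
    have hinx := hin x hfr
    rw [← he] at hinx
    have hx0 : x + (0 : ℝ) • e = x := by simp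
    have hline : Continuous (fun t : ℝ => x + t • e) := by fun_prop
    have hlimR : Tendsto (fun t : ℝ => x + t • e) (𝓝[>] 0) (𝓝 x) := by
      simpa using (hline.tendsto 0).mono_left (nhdsWithin_le_nhds (s := Ioi 0))
    have hlimΩ : Tendsto (fun t : ℝ => x + t • e) (𝓝[>] 0) (𝓝[closure Ω] x) :=
      tendsto_nhdsWithin_iff.2 ⟨hlimR, hinx.mono fun t ht => subset_closure ht⟩
    have hcontx : ContinuousWithinAt (polarComparison u c K a b) (closure Ω) x := by
      refine (hcont x hxA).mono_of_mem_nhdsWithin ?_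
      filter_upwards [mem_nhdsWithin_of_mem_nhds hfar, self_mem_nhdsWithin] with z hz hzΩ
      exact ⟨hzΩ, by simpa using hz.le⟩
    have hderiv : ∀ᶠ t : ℝ in 𝓝[>] 0,
        HasDerivAt (fun s : ℝ => polarComparison u c K a b (x + s • e))
        (⟪Du (x + t • e), e⟫ - c * (⟪x + t • e - a, e⟫ / ‖x + t • e - a‖ ^ 2)
        + K * (-2 * ⟪x + t • e - b, e⟫ / ‖x + t • e - b‖ ^ 4)) t := by
      filter_upwards [hinx, hlimR.eventually (eventually_ne_nhds hxa),
        hlimR.eventually (eventually_ne_nhds hxb)] with t htΩ hta htb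
      refine hasDerivAt_polarComparison_line ?_ hta htb
      simpa using (hgrad _ htΩ).hasFDerivAt.hasDerivAt_line
    have hna : ‖x - a‖ ^ 2 ≠ 0 := pow_ne_zero 2 (norm_ne_zero_iff.2 (sub_ne_zero.2 hxa))
    have hnb : ‖x - b‖ ^ 4 ≠ 0 := pow_ne_zero 4 (norm_ne_zero_iff.2 (sub_ne_zero.2 hxb))
    have hlim : Tendsto (fun t : ℝ =>
        ⟪Du (x + t • e), e⟫ - c * (⟪x + t • e - a, e⟫ / ‖x + t • e - a‖ ^ 2)
        + K * (-2 * ⟪x + t • e - b, e⟫ / ‖x + t • e - b‖ ^ 4)) (𝓝[>] 0)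
        (𝓝 (⟪Du x, e⟫ - c * (⟪x - a, e⟫ / ‖x - a‖ ^ 2)
        + K * (-2 * ⟪x - b, e⟫ / ‖x - b‖ ^ 4))) := by
      have hDu : Tendsto (fun t : ℝ => Du (x + t • e)) (𝓝[>] 0) (𝓝 (Du x)) :=
        (hDucont x hxA.1).tendsto.comp hlimΩ
      have hA := hlimR.sub_const a
      have hB := hlimR.sub_const b
      exact ((hDu.inner tendsto_const_nhds).sub
        (((hA.inner tendsto_const_nhds).div (hA.norm.pow 2) hna).const_mul c)).add
        ((((hB.inner tendsto_const_nhds).const_mul (-2)).div (hB.norm.pow 4) hnb).const_mul K)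
    have hpos : 0 < ⟪Du x, e⟫ - c * (⟪x - a, e⟫ / ‖x - a‖ ^ 2)
        + K * (-2 * ⟪x - b, e⟫ / ‖x - b‖ ^ 4) := by
      have hneg := hbdry x hfr
      simp only [he, inner_neg_right]
      have : -⟪Du x, n x⟫ - c * (-⟪x - a, n x⟫ / ‖x - a‖ ^ 2)
        + K * (-2 * -⟪x - b, n x⟫ / ‖x - b‖ ^ 4) = -(⟪Du x, n x⟫
        - c * (⟪x - a, n x⟫ / ‖x - a‖ ^ 2) + K * (-2 * ⟪x - b, n x⟫ / ‖x - b‖ ^ 4)) := by ring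
      rw [this]
      linarith
    have hcont0 : ContinuousWithinAt (fun s : ℝ => polarComparison u c K a b (x + s • e))
        (Ici 0) 0 := by
      rw [← Ioi_insert, continuousWithinAt_insert_self]
      change Tendsto _ _ (𝓝 (polarComparison u c K a b (x + (0 : ℝ) • e)))
      rw [hx0]
      exact hcontx.tendsto.comp hlimΩ
    have hlt := eventually_lt_of_tendsto_deriv_pos hcont0 hderiv hlim hpos
    obtain ⟨t, hlt, htΩ, htr⟩ := (hlt.and (hinx.and (hlimR.eventually hfar))).exists
    have hle := hxmax ⟨subset_closure htΩ, by simpa using htr.le⟩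
    simp only [hx0] at hlt
    exact absurd hlt (not_lt.2 hle)

end PolarComparison

section Reflection

variable {F : Type*} [NormedAddCommGroup F] [InnerProductSpace ℝ F] {y p ν : F}

lemma norm_sub_sq_le_norm_sub_reflection_sq (hν : ‖ν‖ = 1) (hy : 0 ≤ ⟪p - y, ν⟫) {x : F}
    (hx : ⟪x - p, ν⟫ ≤ 0) : ‖x - y‖ ^ 2 ≤ ‖x - (y + (2 * ⟪p - y, ν⟫) • ν)‖ ^ 2 := by
  have h1 : x - (y + (2 * ⟪p - y, ν⟫) • ν) = (x - y) - (2 * ⟪p - y, ν⟫) • ν := by abel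
  have h2 : ⟪x - y, ν⟫ = ⟪x - p, ν⟫ + ⟪p - y, ν⟫ := by
    rw [← inner_add_left, sub_add_sub_cancel]
  rw [h1, norm_sub_sq_real (x - y), real_inner_smul_right, norm_smul, hν, h2, mul_one,
    Real.norm_eq_abs, sq_abs]
  nlinarith

lemma inner_reflection_sub (hν : ‖ν‖ = 1) :
    ⟪y + (2 * ⟪p - y, ν⟫) • ν - p, ν⟫ = ⟪p - y, ν⟫ := by
  have h1 : y + (2 * ⟪p - y, ν⟫) • ν - p = (2 * ⟪p - y, ν⟫) • ν - (p - y) := by abel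
  rw [h1, inner_sub_left, real_inner_smul_left, real_inner_self_eq_norm_sq, hν]
  ring

/-- The sum of the logarithmic poles at `y` and at its reflection `y + (2 * s) • ν` has
nonnegative derivative along `m`. -/
lemma inner_div_add_inner_reflection_div_nonneg {x m : F} {s : ℝ} (hν : ‖ν‖ = 1) (hm : ‖m‖ = 1)
    (hs : 0 ≤ s) (hle : s ≤ ⟪x - y, m⟫) (hxy : x ≠ y)
    (hdist : ‖x - y‖ ^ 2 ≤ ‖x - (y + (2 * s) • ν)‖ ^ 2) :
    0 ≤ ⟪x - y, m⟫ / ‖x - y‖ ^ 2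
      + ⟪x - (y + (2 * s) • ν), m⟫ / ‖x - (y + (2 * s) • ν)‖ ^ 2 := by
  have hpos : 0 < ‖x - y‖ ^ 2 := by
    have := norm_pos_iff.2 (sub_ne_zero.2 hxy)
    positivity
  have hle1 : ⟪ν, m⟫ ≤ 1 := by
    have := real_inner_le_norm ν m
    rwa [hν, hm, mul_one] at this
  have hnum : -⟪x - y, m⟫ ≤ ⟪x - (y + (2 * s) • ν), m⟫ := by
    rw [← sub_sub, inner_sub_left (x - y), real_inner_smul_left]
    nlinarith
  have h1 : -⟪x - y, m⟫ / ‖x - (y + (2 * s) • ν)‖ ^ 2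
      ≤ ⟪x - (y + (2 * s) • ν), m⟫ / ‖x - (y + (2 * s) • ν)‖ ^ 2 := by gcongr
  have h2 : ⟪x - y, m⟫ / ‖x - (y + (2 * s) • ν)‖ ^ 2 ≤ ⟪x - y, m⟫ / ‖x - y‖ ^ 2 :=
    div_le_div_of_nonneg_left (hs.trans hle) hpos hdist
  rw [neg_div] at h1
  linarith

end Reflection

/-- **Upper bound for the Neumann Robin function, `d = 2`.**
Let `Ω ⊆ ℝ²` be a nonempty open bounded convex set with `C⁴` boundary, `n` an outward unit
normal field on the frontier, and let `q` be the regular part of a symmetric Neumann Green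
function: `Δ_x q = −1/vol(Ω)` on `Ω`, `q(·,y)` and its gradient `Dq(·,y)` extend continuously
to the closure, and `⟪∇_x G + ∇_x q, n⟫ = 0` on the frontier. Then there are `c₁, c₂ > 0`
with `q(x,x) ≤ c₁ + c₂·ln dist(x,∂Ω)` for all `x ∈ Ω`. -/
theorem stmt6 (Ω : Set (EuclideanSpace ℝ (Fin 2)))
    (hopen : IsOpen Ω) (hbd : Bornology.IsBounded Ω) (hconv : Convex ℝ Ω) (hne : Ω.Nonempty)
    (hC4 : IsC4Boundary Ω)
    (n : EuclideanSpace ℝ (Fin 2) → EuclideanSpace ℝ (Fin 2))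
    (hn1 : ∀ x ∈ frontier Ω, ‖n x‖ = 1)
    (hn2 : ∀ x ∈ frontier Ω, ∀ w ∈ Ω, ⟪w - x, n x⟫ ≤ 0)
    (q : EuclideanSpace ℝ (Fin 2) → EuclideanSpace ℝ (Fin 2) → ℝ)
    (Dq : EuclideanSpace ℝ (Fin 2) → EuclideanSpace ℝ (Fin 2) → EuclideanSpace ℝ (Fin 2))
    (hsymm : ∀ x ∈ Ω, ∀ y ∈ Ω, q x y = q y x)
    (hsmooth : ∀ y ∈ Ω, ContDiffOn ℝ 2 (fun x => q x y) Ω)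
    (hlap : ∀ y ∈ Ω, ∀ x ∈ Ω, ∑ i : Fin 2,
        iteratedFDerivWithin ℝ 2 (fun x => q x y) Ω x
          ![EuclideanSpace.single i 1, EuclideanSpace.single i 1]
      = -1 / (MeasureTheory.volume Ω).toReal)
    (hgrad : ∀ y ∈ Ω, ∀ x ∈ Ω, HasGradientAt (fun x => q x y) (Dq x y) x)
    (hqcont : ∀ y ∈ Ω, ContinuousOn (fun x => q x y) (closure Ω))
    (hDqcont : ∀ y ∈ Ω, ContinuousOn (fun x => Dq x y) (closure Ω))
    (hneu : ∀ y ∈ Ω, ∀ x ∈ frontier Ω,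
      ⟪gradient (fun x' => fundSol2 x' y) x + Dq x y, n x⟫ = 0) :
    ∃ c₁ > 0, ∃ c₂ > 0, ∀ x ∈ Ω,
      q x x ≤ c₁ + c₂ * Real.log (Metric.infDist x (frontier Ω)) := by
  have hin : ∀ x ∈ frontier Ω, ∀ᶠ t : ℝ in 𝓝[>] 0, x + t • (-n x) ∈ Ω := fun x hx =>
    hC4.eventually_sub_normal_mem hx (hn1 x hx) (hn2 x hx)
  have hbound : ∀ x ∈ Ω, ∃ M, ∀ y ∈ Ω, q x y ≤ M := by
    intro x hx
    obtain ⟨M, hM⟩ := hbd.isCompact_closure.bddAbove_image (hqcont x hx)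
    exact ⟨M, fun y hy => hsymm x hx y hy ▸ hM (mem_image_of_mem _ (subset_closure hy))⟩
  obtain ⟨b, R, k, hR, hballR, hk⟩ := exists_closedBall_forall_le hopen hne
    (fun y hy => (hqcont y hy).mono subset_closure) hbound
  have hr : 0 < R / 2 := half_pos hR
  have hballr : Metric.closedBall b (R / 2) ⊆ Metric.closedBall b R :=
    Metric.closedBall_subset_closedBall (by linarith)
  obtain ⟨D, hD0, hD⟩ : ∃ D, 0 < D ∧ ∀ x ∈ Ω, ‖x - b‖ ≤ D := by
    obtain ⟨D, hD⟩ := (Metric.isBounded_iff_subset_closedBall b).1 hbd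
    refine ⟨max D 1, by positivity, fun x hx => ?_⟩
    rw [← dist_eq_norm]
    exact (Metric.mem_closedBall.1 (hD hx)).trans (le_max_left _ _)
  set α : ℝ := -1 / (MeasureTheory.volume Ω).toReal with hα
  set K : ℝ := (|α| + 1) * D ^ 4 with hK
  have hK0 : 0 < K := by positivity
  have hfrne : (frontier Ω).Nonempty := nonempty_frontier_iff.2
    ⟨hne, fun h => NormedSpace.unbounded_univ ℝ (EuclideanSpace ℝ (Fin 2)) (h ▸ hbd)⟩
  have hfrcompact : IsCompact (frontier Ω) :=
    hbd.isCompact_closure.of_isClosed_subset isClosed_frontier frontier_subset_closure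
  have hfrΩ : ∀ x ∈ frontier Ω, x ∉ Ω := fun x hx =>
    (hopen.frontier_eq.subset hx).2
  set c : ℝ := 1 / (2 * Real.pi) with hc
  have hc0 : 0 < c := by positivity
  set C : ℝ := k - c * Real.log (R / 2) + K * ((R / 2) ^ 2)⁻¹ with hC
  refine ⟨|k| + |C| + c * |Real.log (R / 2)| + c * Real.log 2 + 1, ?_, c, hc0, fun y hy => ?_⟩
  · have := Real.log_pos one_lt_two
    positivity
  have hlog2 := mul_pos hc0 (Real.log_pos one_lt_two)
  set d := Metric.infDist y (frontier Ω) with hd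
  have hd0 : 0 < d := (isClosed_frontier.notMem_iff_infDist_pos hfrne).1 fun h => hfrΩ y h hy
  rcases lt_or_ge (dist y b) (R / 2) with hyb | hyb
  · have hqy := hk y (Metric.mem_closedBall.2 (by linarith)) y hy
    have hdR : R / 2 ≤ d := by
      refine (Metric.le_infDist hfrne).2 fun z hz => ?_
      have hzb : R < dist z b := by
        by_contra! h
        exact hfrΩ z hz (hballR h)
      have := dist_triangle_left z b y
      linarith
    have hlog := mul_le_mul_of_nonneg_left (Real.log_le_log hr hdR) hc0.le
    have habs := mul_le_mul_of_nonneg_left (neg_abs_le (Real.log (R / 2))) hc0.le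
    have := le_abs_self k
    have := abs_nonneg C
    linarith
  · obtain ⟨p, hp, hpd⟩ := hfrcompact.exists_infDist_eq_dist hfrne y
    set s := ⟪p - y, n p⟫ with hs
    have hball : Metric.ball y d ⊆ Ω := ball_infDist_frontier_subset hopen hy
    have hds : d ≤ s := le_inner_of_ball_subset (hn1 p hp) (hn2 p hp) hd0 hball
    have hsd : s ≤ d := by
      have := real_inner_le_norm (p - y) (n p)
      rwa [hn1 p hp, mul_one, ← dist_eq_norm, dist_comm, ← hpd] at this
    have hs0 : 0 < s := hd0.trans_le hds
    set a := y + (2 * s) • n p with ha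
    have haΩ : a ∉ closure Ω := fun h => by
      have h1 := inner_nonpos_of_mem_closure (hn2 p hp) h
      rw [ha, hs, inner_reflection_sub (hn1 p hp)] at h1
      linarith
    have hlap' : ∀ x ∈ Ω, x ≠ b → 0 < ∑ i : Fin 2, iteratedFDeriv ℝ 2 (fun x => q x y) x
        ![EuclideanSpace.single i 1, EuclideanSpace.single i 1] + 4 * K / ‖x - b‖ ^ 4 := by
      intro x hx hxb
      have h1 := hlap y hy x hx
      rw [iteratedFDerivWithin_of_isOpen 2 hopen hx] at h1
      rw [h1]
      have hpos : 0 < ‖x - b‖ := norm_pos_iff.2 (sub_ne_zero.2 hxb)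
      have hle : ‖x - b‖ ^ 4 ≤ D ^ 4 := pow_le_pow_left₀ hpos.le (hD x hx) 4
      have h2 : |α| + 1 ≤ 4 * K / ‖x - b‖ ^ 4 := by
        rw [le_div_iff₀ (by positivity)]
        calc (|α| + 1) * ‖x - b‖ ^ 4 ≤ (|α| + 1) * D ^ 4 := by gcongr
          _ ≤ 4 * K := by linarith
      linarith [neg_abs_le α]
    have hbdry : ∀ x ∈ frontier Ω, ⟪Dq x y, n x⟫ - c * (⟪x - a, n x⟫ / ‖x - a‖ ^ 2)
        + K * (-2 * ⟪x - b, n x⟫ / ‖x - b‖ ^ 4) < 0 := by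
      intro x hx
      have hxy : x ≠ y := by
        rintro rfl
        exact hfrΩ x hx hy
      have hxb : 0 < ‖x - b‖ := by
        refine norm_pos_iff.2 (sub_ne_zero.2 ?_)
        rintro rfl
        exact hfrΩ x hx (hballR (Metric.mem_closedBall_self hR.le))
      have h1 := hneu y hy x hx
      rw [inner_add_left] at h1
      simp only [fundSol2] at h1
      rw [inner_gradient_log_norm hxy, ← hc] at h1
      have hdist : ‖x - y‖ ^ 2 ≤ ‖x - a‖ ^ 2 :=
        norm_sub_sq_le_norm_sub_reflection_sq (hn1 p hp) hs0.le
          (inner_nonpos_of_mem_closure (hn2 p hp) (frontier_subset_closure hx))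
      have h2 := inner_div_add_inner_reflection_div_nonneg (hn1 p hp) (hn1 x hx) hs0.le
        (hsd.trans (le_inner_of_ball_subset (hn1 x hx) (hn2 x hx) hd0 hball)) hxy hdist
      have h3 : R ≤ ⟪x - b, n x⟫ := le_inner_of_ball_subset (hn1 x hx) (hn2 x hx) hR
        (Metric.ball_subset_closedBall.trans hballR)
      have h4 : K * (-2 * ⟪x - b, n x⟫ / ‖x - b‖ ^ 4) < 0 :=
        mul_neg_of_pos_of_neg hK0 (div_neg_of_neg_of_pos (by linarith) (by positivity))
      have h5 := mul_nonneg hc0.le h2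
      rw [mul_add] at h5
      linarith
    obtain ⟨z, hz, hle⟩ := exists_sphere_polarComparison_le hopen hbd hin (hsmooth y hy)
      (hgrad y hy) (hqcont y hy) (hDqcont y hy) hr haΩ hlap' hbdry hy hyb
    have hzb : ‖z - b‖ = R / 2 := by rw [← dist_eq_norm, Metric.mem_sphere.1 hz]
    have hqz := hk z (hballr (Metric.sphere_subset_closedBall hz)) y hy
    have hza : R / 2 ≤ ‖z - a‖ := by
      have hab : R < dist a b := by
        by_contra! h
        exact haΩ (subset_closure (hballR h))
      have := dist_triangle_left a b z
      rw [Metric.mem_sphere.1 hz, dist_eq_norm z a] at this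
      linarith
    have hlogz := mul_le_mul_of_nonneg_left (Real.log_le_log hr hza) hc0.le
    have hya : ‖y - a‖ = 2 * s := by
      rw [ha, sub_add_cancel_left, norm_neg, norm_smul, hn1 p hp, mul_one, Real.norm_eq_abs,
        abs_of_pos (by positivity)]
    have hlogy : Real.log (2 * s) ≤ Real.log 2 + Real.log d := by
      rw [← Real.log_mul two_ne_zero hd0.ne']
      exact Real.log_le_log (by positivity) (by linarith)
    have hlogy' := mul_le_mul_of_nonneg_left hlogy hc0.le
    have hinv : 0 ≤ K * (‖y - b‖ ^ 2)⁻¹ := by positivity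
    simp only [polarComparison, hzb, hya] at hle
    have := le_abs_self C
    have := abs_nonneg k
    have := mul_nonneg hc0.le (abs_nonneg (Real.log (R / 2)))
    rw [mul_add] at hlogy'
    linarith
end

section
/- Let d ≥ 2 be an integer and C₀, C₁, D > 0. There exists a constant C > 0, depending only on d, C₀, C₁, D, such that the following holds. Let K ⊆ ℝ^d be a nonempty compact set with diameter at most D; let μ be a Borel measure on ℝ^d with support contained in K satisfying μ(B(z,r)) ≤ C₀·r^{d−1} for all z ∈ ℝ^d and r > 0; and let n : K → ℝ^d satisfy ‖n(w)‖ ≤ 1 and |⟪n(w), z − w⟫| ≤ C₁·‖z − w‖² for all w, z ∈ K. Then for every x ∈ ℝ^d with 0 < dist(x, K) ≤ D, ∫_K |⟪n(w), x − w⟫| / ‖x − w‖^d dμ(w) ≤ C. -/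
open MeasureTheory
open scoped RealInnerProductSpace

/-- The (topological) support of a measure on `ℝ^d`: points all of whose neighborhoods have
positive measure. -/
def msupport {d : ℕ} (μ : Measure (EuclideanSpace ℝ (Fin d))) :
    Set (EuclideanSpace ℝ (Fin d)) :=
  {x | ∀ r > 0, 0 < μ (Metric.ball x r)}

/-- A countable cover on whose `k`-th piece `f ≤ a k`, with measure at most `b k` and
`a k * b k ≤ A / 2 ^ k`, bounds the integral of `f` by `2 * A`. -/
theorem setLIntegral_le_of_geometric_cover {X : Type*} [MeasurableSpace X] {μ : Measure X}
    {K : Set X} {S : ℕ → Set X} (hS : ∀ k, MeasurableSet (S k)) (hK : K ⊆ ⋃ k, S k)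
    {f : X → ℝ} {a b : ℕ → ℝ} {A : ℝ} (ha : ∀ k, 0 ≤ a k)
    (hf : ∀ k, ∀ w ∈ S k, f w ≤ a k) (hμ : ∀ k, μ (S k) ≤ ENNReal.ofReal (b k))
    (hA : 0 ≤ A) (hab : ∀ k, a k * b k ≤ A * (1 / 2) ^ k) :
    ∫⁻ w in K, ENNReal.ofReal (f w) ∂μ ≤ ENNReal.ofReal (2 * A) := by
  have piece : ∀ k, ∫⁻ w in S k, ENNReal.ofReal (f w) ∂μ ≤ ENNReal.ofReal (A * (1 / 2) ^ k) := by
    intro k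
    calc ∫⁻ w in S k, ENNReal.ofReal (f w) ∂μ
        ≤ ∫⁻ _ in S k, ENNReal.ofReal (a k) ∂μ :=
          setLIntegral_mono' (hS k) fun w hw => ENNReal.ofReal_le_ofReal (hf k w hw)
      _ = ENNReal.ofReal (a k) * μ (S k) := setLIntegral_const _ _
      _ ≤ ENNReal.ofReal (a k) * ENNReal.ofReal (b k) := by gcongr; exact hμ k
      _ = ENNReal.ofReal (a k * b k) := (ENNReal.ofReal_mul (ha k)).symm
      _ ≤ _ := ENNReal.ofReal_le_ofReal (hab k)
  have hsum : HasSum (fun k : ℕ => A * (1 / 2 : ℝ) ^ k) (2 * A) := by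
    simpa [mul_comm] using hasSum_geometric_two.mul_left A
  calc ∫⁻ w in K, ENNReal.ofReal (f w) ∂μ
      ≤ ∫⁻ w in ⋃ k, S k, ENNReal.ofReal (f w) ∂μ := lintegral_mono_set hK
    _ ≤ ∑' k, ∫⁻ w in S k, ENNReal.ofReal (f w) ∂μ := lintegral_iUnion_le _ _
    _ ≤ ∑' k, ENNReal.ofReal (A * (1 / 2) ^ k) := ENNReal.tsum_le_tsum piece
    _ = ENNReal.ofReal (2 * A) := by
      rw [← ENNReal.ofReal_tsum_of_nonneg (fun k => by positivity) hsum.summable, hsum.tsum_eq]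

section UpperRegular

variable {X : Type*} [PseudoMetricSpace X] [MeasurableSpace X] [OpensMeasurableSpace X]
  {μ : Measure X} {x : X} {C₀ : ℝ} {m : ℕ}

/-- Decay at infinity: if `μ (B(x,r)) ≤ C₀ r ^ (m+1)`, the integral of `dist(w,x) ^ (-(m+2))`
away from `B(x,δ)` is `O(1 / δ)`. -/
theorem setLIntegral_one_div_dist_pow_outside_ball_le (hC₀ : 0 ≤ C₀)
    (hμ : ∀ r > 0, μ (Metric.ball x r) ≤ ENNReal.ofReal (C₀ * r ^ (m + 1)))
    {δ : ℝ} (hδ : 0 < δ) {K : Set X} (hK : ∀ w ∈ K, δ ≤ dist w x) :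
    ∫⁻ w in K, ENNReal.ofReal (1 / dist w x ^ (m + 2)) ∂μ ≤
      ENNReal.ofReal (2 * (C₀ * 2 ^ (m + 1) / δ)) := by
  refine setLIntegral_le_of_geometric_cover
    (S := fun k => {w | 2 ^ k * δ ≤ dist w x} ∩ Metric.ball x (2 ^ (k + 1) * δ))
    (a := fun k => 1 / (2 ^ k * δ) ^ (m + 2))
    (b := fun k => C₀ * (2 ^ (k + 1) * δ) ^ (m + 1)) ?_ ?_ ?_ ?_ ?_ (by positivity) ?_
  · intro k
    exact (isClosed_le continuous_const (continuous_id.dist continuous_const)).measurableSet.inter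
      measurableSet_ball
  · intro w hw
    obtain ⟨k, hk₁, hk₂⟩ :=
      exists_nat_pow_near ((one_le_div hδ).2 (hK w hw)) (one_lt_two (α := ℝ))
    exact Set.mem_iUnion.2 ⟨k, (le_div_iff₀ hδ).1 hk₁, (div_lt_iff₀ hδ).1 hk₂⟩
  · intro k
    positivity
  · rintro k w ⟨hw, -⟩
    have hw : 2 ^ k * δ ≤ dist w x := hw
    gcongr
  · intro k
    exact (measure_mono Set.inter_subset_right).trans (hμ _ (by positivity))
  · intro k
    apply le_of_eq
    simp only [one_div, inv_pow]
    field_simp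
    ring

/-- Local integrability: if `μ (B(x,r)) ≤ C₀ r ^ (m+1)`, the integral of `dist(w,x) ^ (-m)`
over the punctured closed ball of radius `R` is `O(R)`. -/
theorem setLIntegral_one_div_dist_pow_inside_ball_le (hC₀ : 0 ≤ C₀)
    (hμ : ∀ r > 0, μ (Metric.ball x r) ≤ ENNReal.ofReal (C₀ * r ^ (m + 1)))
    {R : ℝ} (hR : 0 < R) {K : Set X} (hK : ∀ w ∈ K, 0 < dist w x ∧ dist w x ≤ R) :
    ∫⁻ w in K, ENNReal.ofReal (1 / dist w x ^ m) ∂μ ≤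
      ENNReal.ofReal (2 * (C₀ * 2 ^ (2 * m + 1) * R)) := by
  refine setLIntegral_le_of_geometric_cover
    (S := fun k => {w | (1 / 2) ^ (k + 1) * R ≤ dist w x} ∩ Metric.ball x (2 * ((1 / 2) ^ k * R)))
    (a := fun k => 1 / ((1 / 2) ^ (k + 1) * R) ^ m)
    (b := fun k => C₀ * (2 * ((1 / 2) ^ k * R)) ^ (m + 1)) ?_ ?_ ?_ ?_ ?_ (by positivity) ?_
  · intro k
    exact (isClosed_le continuous_const (continuous_id.dist continuous_const)).measurableSet.inter
      measurableSet_ball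
  · intro w hw
    obtain ⟨hpos, hle⟩ := hK w hw
    obtain ⟨k, hk₁, hk₂⟩ := exists_nat_pow_near_of_lt_one (div_pos hpos hR)
      ((div_le_one hR).2 hle) (one_half_pos (α := ℝ)) one_half_lt_one
    rw [lt_div_iff₀ hR] at hk₁
    rw [div_le_iff₀ hR] at hk₂
    refine Set.mem_iUnion.2 ⟨k, hk₁.le, ?_⟩
    rw [Metric.mem_ball]
    linarith
  · intro k
    positivity
  · rintro k w ⟨hw, -⟩
    have hw : (1 / 2) ^ (k + 1) * R ≤ dist w x := hw
    gcongr
  · intro k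
    exact (measure_mono Set.inter_subset_right).trans (hμ _ (by positivity))
  · intro k
    apply le_of_eq
    simp only [one_div, inv_pow, mul_pow]
    field_simp
    ring

end UpperRegular

/-- If `z` is a nearest point to `x` and the tangency bound holds between `w` and `z`, the double
layer numerator is at most `dist(x,z) + 4 C₁ ‖x - w‖ ^ 2`. -/
theorem abs_inner_sub_le_of_tangency {E : Type*} [NormedAddCommGroup E] [InnerProductSpace ℝ E]
    {C₁ : ℝ} (hC₁ : 0 ≤ C₁) {v w x z : E} (hv : ‖v‖ ≤ 1)
    (htan : |⟪v, z - w⟫| ≤ C₁ * ‖z - w‖ ^ 2) (hz : ‖x - z‖ ≤ ‖x - w‖) :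
    |⟪v, x - w⟫| ≤ ‖x - z‖ + 4 * C₁ * ‖x - w‖ ^ 2 := by
  have hsplit : ⟪v, x - w⟫ = ⟪v, x - z⟫ + ⟪v, z - w⟫ := by
    rw [← inner_add_right, sub_add_sub_cancel]
  have hnormal : |⟪v, x - z⟫| ≤ ‖x - z‖ :=
    (abs_real_inner_le_norm _ _).trans (mul_le_of_le_one_left (norm_nonneg _) hv)
  have hzw : ‖z - w‖ ≤ 2 * ‖x - w‖ := by
    have := norm_sub_le_norm_sub_add_norm_sub z x w
    rw [norm_sub_rev z x] at this
    linarith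
  calc |⟪v, x - w⟫| ≤ |⟪v, x - z⟫| + |⟪v, z - w⟫| := hsplit ▸ abs_add_le _ _
    _ ≤ ‖x - z‖ + C₁ * (2 * ‖x - w‖) ^ 2 := by
      refine add_le_add hnormal (htan.trans ?_)
      gcongr
    _ = _ := by ring

/-- **Uniform bound on the double layer potential kernel integral.**
For `d ≥ 2` and `C₀, C₁, D > 0` there is `C > 0`, depending only on `d, C₀, C₁, D`, such that:
for every nonempty compact `K ⊆ ℝ^d` of diameter at most `D`, every Borel measure `μ`
supported in `K` which is upper Ahlfors regular of dimension `d − 1` with constant `C₀`, and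
every field `n : K → ℝ^d` with `‖n(w)‖ ≤ 1` and the quadratic tangency bound
`|⟪n(w), z − w⟫| ≤ C₁‖z − w‖²` on `K`, one has, for every `x` with `0 < dist(x,K) ≤ D`,
`∫_K |⟪n(w), x − w⟫|/‖x − w‖^d dμ(w) ≤ C`. -/
theorem stmt9 (d : ℕ) (hd : 2 ≤ d) (C₀ C₁ D : ℝ) (hC₀ : 0 < C₀) (hC₁ : 0 < C₁) (hD : 0 < D) :
    ∃ C > 0, ∀ K : Set (EuclideanSpace ℝ (Fin d)),
      IsCompact K → K.Nonempty → Metric.diam K ≤ D →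
      ∀ μ : Measure (EuclideanSpace ℝ (Fin d)),
        msupport μ ⊆ K →
        (∀ z, ∀ r > 0, μ (Metric.ball z r) ≤ ENNReal.ofReal (C₀ * r ^ ((d : ℝ) - 1))) →
        ∀ n : EuclideanSpace ℝ (Fin d) → EuclideanSpace ℝ (Fin d),
          (∀ w ∈ K, ‖n w‖ ≤ 1) →
          (∀ w ∈ K, ∀ z ∈ K, |⟪n w, z - w⟫| ≤ C₁ * ‖z - w‖ ^ 2) →
          ∀ x : EuclideanSpace ℝ (Fin d),
            0 < Metric.infDist x K → Metric.infDist x K ≤ D →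
            ∫⁻ w in K, ENNReal.ofReal (|⟪n w, x - w⟫| / ‖x - w‖ ^ d) ∂μ ≤
              ENNReal.ofReal C := by
  obtain ⟨m, rfl⟩ := Nat.exists_eq_add_of_le' hd
  refine ⟨2 * (C₀ * 2 ^ (m + 1)) + 4 * C₁ * (2 * (C₀ * 2 ^ (2 * m + 1) * (2 * D))),
    by positivity, ?_⟩
  intro K hK hKne hdiam μ _ hμ n hn htan x hx₀ hxD
  obtain ⟨z, hzK, hz⟩ := hK.exists_infDist_eq_dist hKne x
  rw [hz] at hx₀ hxD
  have hμx : ∀ r > 0, μ (Metric.ball x r) ≤ ENNReal.ofReal (C₀ * r ^ (m + 1)) := by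
    intro r hr
    have hexp : ((m + 2 : ℕ) : ℝ) - 1 = ((m + 1 : ℕ) : ℝ) := by push_cast; ring
    simpa only [hexp, Real.rpow_natCast] using hμ x r hr
  have hnear : ∀ w ∈ K, dist x z ≤ dist w x := by
    intro w hw
    rw [← hz, dist_comm w x]
    exact Metric.infDist_le_dist_of_mem hw
  have hfar : ∀ w ∈ K, 0 < dist w x ∧ dist w x ≤ 2 * D := by
    intro w hw
    refine ⟨hx₀.trans_le (hnear w hw), ?_⟩
    have hwz := (Metric.dist_le_diam_of_mem hK.isBounded hw hzK).trans hdiam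
    have htri := dist_triangle w z x
    rw [dist_comm z x] at htri
    linarith
  have hpt : ∀ w ∈ K, ENNReal.ofReal (|⟪n w, x - w⟫| / ‖x - w‖ ^ (m + 2)) ≤
      ENNReal.ofReal (dist x z) * ENNReal.ofReal (1 / dist w x ^ (m + 2)) +
        ENNReal.ofReal (4 * C₁) * ENNReal.ofReal (1 / dist w x ^ m) := by
    intro w hw
    have hpos := (hfar w hw).1
    rw [← ENNReal.ofReal_mul hx₀.le, ← ENNReal.ofReal_mul (by positivity),
      ← ENNReal.ofReal_add (by positivity) (by positivity)]
    apply ENNReal.ofReal_le_ofReal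
    have hnum := abs_inner_sub_le_of_tangency hC₁.le (hn w hw) (htan w hw z hzK)
      (x := x) (by simpa only [← dist_eq_norm, dist_comm x w] using hnear w hw)
    rw [← dist_eq_norm, ← dist_eq_norm, dist_comm x w] at hnum
    rw [← dist_eq_norm, dist_comm x w, div_le_iff₀ (by positivity)]
    refine hnum.trans_eq ?_
    field_simp
    ring
  calc _ ≤ ∫⁻ w in K, (ENNReal.ofReal (dist x z) * ENNReal.ofReal (1 / dist w x ^ (m + 2)) +
        ENNReal.ofReal (4 * C₁) * ENNReal.ofReal (1 / dist w x ^ m)) ∂μ :=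
        setLIntegral_mono' hK.measurableSet hpt
    _ = ENNReal.ofReal (dist x z) * ∫⁻ w in K, ENNReal.ofReal (1 / dist w x ^ (m + 2)) ∂μ +
        ENNReal.ofReal (4 * C₁) * ∫⁻ w in K, ENNReal.ofReal (1 / dist w x ^ m) ∂μ := by
      rw [lintegral_add_left (by fun_prop), lintegral_const_mul _ (by fun_prop),
        lintegral_const_mul _ (by fun_prop)]
    _ ≤ ENNReal.ofReal (dist x z) * ENNReal.ofReal (2 * (C₀ * 2 ^ (m + 1) / dist x z)) +
        ENNReal.ofReal (4 * C₁) * ENNReal.ofReal (2 * (C₀ * 2 ^ (2 * m + 1) * (2 * D))) := by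
      gcongr
      · exact setLIntegral_one_div_dist_pow_outside_ball_le hC₀.le hμx hx₀ hnear
      · exact setLIntegral_one_div_dist_pow_inside_ball_le hC₀.le hμx (by positivity) hfar
    _ = _ := by
      rw [← ENNReal.ofReal_mul hx₀.le, ← ENNReal.ofReal_mul (by positivity),
        ← ENNReal.ofReal_add (by positivity) (by positivity)]
      congr 2
      field_simp
end

section
/- There exists an absolute constant C > 0 such that the following holds. Let A, R > 0, let v₀ ∈ ℝ³, and let f : ℝ³ × ℝ³ → ℝ be measurable with 0 ≤ f(x,v) ≤ A for almost every (x,v). Define ρ(x) = ∫_{{v ∈ ℝ³ : ‖v − v₀‖ < R}} f(x,v) dv. Then for every x ∈ ℝ³, ∫_{ℝ³} ρ(y)·‖x − y‖^{−2} dy ≤ C · A^{4/9} · ‖ρ‖_{L^{5/3}(ℝ³)}^{5/9} · R^{4/3}. -/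
open MeasureTheory

/-- Integration of a nonnegative radial function on `ℝ³` in polar coordinates. -/
theorem lintegral_ofReal_radial {g : ℝ → ℝ} (hg : ∀ t, 0 ≤ t → 0 ≤ g t)
    (hg_int : IntegrableOn (fun t => t ^ 2 * g t) (Set.Ioi 0)) (x : EuclideanSpace ℝ (Fin 3)) :
    ∫⁻ y : EuclideanSpace ℝ (Fin 3), ENNReal.ofReal (g ‖x - y‖) =
      ENNReal.ofReal (3 * volume.real (Metric.ball (0 : EuclideanSpace ℝ (Fin 3)) 1) *
        ∫ t in Set.Ioi (0 : ℝ), t ^ 2 * g t) := by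
  rw [lintegral_sub_left_eq_self (fun y => ENNReal.ofReal (g ‖y‖)) x]
  have hg_int' : Integrable (fun y : EuclideanSpace ℝ (Fin 3) => g ‖y‖) := by
    rw [integrable_fun_norm_addHaar volume]
    simpa using hg_int
  rw [← ofReal_integral_eq_lintegral_ofReal hg_int' (.of_forall fun y => hg _ (norm_nonneg y)),
    integral_fun_norm_addHaar volume g]
  simp [mul_assoc]

/-- The Coulomb kernel integrated over a ball around its pole. -/
theorem setLIntegral_ball_norm_rpow_neg_two (x : EuclideanSpace ℝ (Fin 3)) {r : ℝ} (hr : 0 < r) :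
    ∫⁻ y in Metric.ball x r, ENNReal.ofReal (‖x - y‖ ^ (-2 : ℝ)) =
      ENNReal.ofReal (3 * volume.real (Metric.ball (0 : EuclideanSpace ℝ (Fin 3)) 1) * r) := by
  have heq : Set.EqOn (fun t : ℝ => t ^ 2 * (Set.Iio r).indicator (fun t => t ^ (-2 : ℝ)) t)
      ((Set.Iio r).indicator fun _ => 1) (Set.Ioi 0) := by
    intro t ht
    have ht : 0 < t := ht
    by_cases h : t < r
    · simp only [Set.mem_Iio, h, Set.indicator_of_mem]
      rw [← Real.rpow_natCast, ← Real.rpow_add ht]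
      norm_num
    · simp [h]
  have hset : Set.Iio r ∩ Set.Ioi 0 = Set.Ioo 0 r := by
    ext t; simp [and_comm]
  have key := lintegral_ofReal_radial (g := (Set.Iio r).indicator fun t => t ^ (-2 : ℝ))
    (fun t ht => Set.indicator_apply_nonneg fun _ => Real.rpow_nonneg ht _) (by
      rw [integrableOn_congr_fun heq measurableSet_Ioi, IntegrableOn,
        integrable_indicator_iff measurableSet_Iio, IntegrableOn,
        Measure.restrict_restrict measurableSet_Iio, hset]
      simp) x
  rw [setIntegral_congr_fun measurableSet_Ioi heq, integral_indicator measurableSet_Iio,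
    Measure.restrict_restrict measurableSet_Iio, hset] at key
  rw [← lintegral_indicator Metric.isOpen_ball.measurableSet]
  convert key using 2
  · ext y
    by_cases h : ‖x - y‖ < r
    · simp [Set.indicator, Metric.mem_ball, dist_eq_norm, norm_sub_rev y x, h]
    · simp [Set.indicator, Metric.mem_ball, dist_eq_norm, norm_sub_rev y x, h]
  · simp [hr.le]

/-- The power `‖x - y‖⁻⁵` integrated over the exterior of a ball around `x`. -/
theorem setLIntegral_compl_ball_norm_rpow_neg_five (x : EuclideanSpace ℝ (Fin 3)) {r : ℝ}
    (hr : 0 < r) :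
    ∫⁻ y in (Metric.ball x r)ᶜ, ENNReal.ofReal (‖x - y‖ ^ (-5 : ℝ)) =
      ENNReal.ofReal (3 * volume.real (Metric.ball (0 : EuclideanSpace ℝ (Fin 3)) 1) *
        (r ^ (-2 : ℝ) / 2)) := by
  have heq : Set.EqOn (fun t : ℝ => t ^ 2 * (Set.Ici r).indicator (fun t => t ^ (-5 : ℝ)) t)
      ((Set.Ici r).indicator fun t => t ^ (-3 : ℝ)) (Set.Ioi 0) := by
    intro t ht
    have ht : 0 < t := ht
    by_cases h : r ≤ t
    · simp only [Set.mem_Ici, h, Set.indicator_of_mem]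
      rw [← Real.rpow_natCast, ← Real.rpow_add ht]
      norm_num
    · simp [h]
  have hset : Set.Ici r ∩ Set.Ioi 0 = Set.Ici r := by
    ext t; simp only [Set.mem_inter_iff, Set.mem_Ici, Set.mem_Ioi, and_iff_left_iff_imp]
    exact hr.trans_le
  have key := lintegral_ofReal_radial (g := (Set.Ici r).indicator fun t => t ^ (-5 : ℝ))
    (fun t ht => Set.indicator_apply_nonneg fun _ => Real.rpow_nonneg ht _) (by
      rw [integrableOn_congr_fun heq measurableSet_Ioi, IntegrableOn,
        integrable_indicator_iff measurableSet_Ici, IntegrableOn,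
        Measure.restrict_restrict measurableSet_Ici, hset, ← IntegrableOn,
        integrableOn_Ici_iff_integrableOn_Ioi]
      exact integrableOn_Ioi_rpow_of_lt (by norm_num) hr) x
  rw [setIntegral_congr_fun measurableSet_Ioi heq, integral_indicator measurableSet_Ici,
    Measure.restrict_restrict measurableSet_Ici, hset, integral_Ici_eq_integral_Ioi,
    integral_Ioi_rpow_of_lt (by norm_num) hr] at key
  rw [← lintegral_indicator Metric.isOpen_ball.measurableSet.compl]
  convert key using 2
  · ext y
    by_cases h : ‖x - y‖ < r
    · simp [Set.indicator, Metric.mem_ball, dist_eq_norm, norm_sub_rev y x, h, h.not_ge]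
    · simp [Set.indicator, Metric.mem_ball, dist_eq_norm, norm_sub_rev y x, h, not_lt.1 h]
  · congr 1
    norm_num

/-- Splitting the Coulomb potential of a bounded density at radius `r`: the near part is controlled
by the supremum, the far part by the `L^{5/3}` norm. -/
theorem lintegral_div_sq_le_of_radius {h : EuclideanSpace ℝ (Fin 3) → ENNReal}
    (hh : AEMeasurable h) {M : ENNReal} (hM : ∀ᵐ y, h y ≤ M)
    (x : EuclideanSpace ℝ (Fin 3)) {r : ℝ} (hr : 0 < r) :
    ∫⁻ y, h y / (‖x - y‖₊ : ENNReal) ^ 2 ≤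
      M * ENNReal.ofReal
        (3 * volume.real (Metric.ball (0 : EuclideanSpace ℝ (Fin 3)) 1) * r) +
      (∫⁻ y, h y ^ (5 / 3 : ℝ)) ^ (3 / 5 : ℝ) * ENNReal.ofReal
        (3 * volume.real (Metric.ball (0 : EuclideanSpace ℝ (Fin 3)) 1) *
          (r ^ (-2 : ℝ) / 2)) ^ (2 / 5 : ℝ) := by
  have hker : ∀ᵐ y, h y / (‖x - y‖₊ : ENNReal) ^ 2 =
      h y * ENNReal.ofReal (‖x - y‖ ^ (-2 : ℝ)) := by
    filter_upwards [compl_mem_ae_iff.2 (measure_singleton x)] with y hy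
    have hpos : 0 < ‖x - y‖ := norm_pos_iff.2 (sub_ne_zero.2 fun e => hy (by simp [e]))
    rw [div_eq_mul_inv, Real.rpow_neg hpos.le, ENNReal.ofReal_inv_of_pos (by positivity)]
    congr 2
    rw [Real.rpow_two, ENNReal.ofReal_pow hpos.le, ofReal_norm]
    rfl
  rw [lintegral_congr_ae hker,
    ← lintegral_add_compl _ (Metric.isOpen_ball (x := x) (ε := r)).measurableSet]
  gcongr ?_ + ?_
  · rw [← setLIntegral_ball_norm_rpow_neg_two x hr, ← lintegral_const_mul _ (by fun_prop)]
    refine lintegral_mono_ae ?_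
    filter_upwards [ae_restrict_of_ae hM] with y hy
    gcongr
  · have hpq : (5 / 3 : ℝ).HolderConjugate (5 / 2) := by
      rw [Real.holderConjugate_iff]; norm_num
    refine (ENNReal.lintegral_mul_le_Lp_mul_Lq _ hpq hh.restrict (by fun_prop)).trans ?_
    rw [← setLIntegral_compl_ball_norm_rpow_neg_five x hr]
    norm_num only
    gcongr ?_ ^ _ * ?_ ^ _
    · exact setLIntegral_le_lintegral _ _
    · refine le_of_eq (lintegral_congr fun y => ?_)
      rw [ENNReal.ofReal_rpow_of_nonneg (by positivity) (by norm_num),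
        ← Real.rpow_mul (norm_nonneg _)]
      norm_num

/-- The value of the near-far splitting bound at the radius balancing its two terms. -/
theorem near_far_bound_at_balanced_radius {k M n : ℝ} (hk : 0 ≤ k) (hM : 0 < M) (hn : 0 < n) :
    M * (3 * k * (n / M) ^ (5 / 9 : ℝ)) +
      n * (3 * k * (((n / M) ^ (5 / 9 : ℝ)) ^ (-2 : ℝ) / 2)) ^ (2 / 5 : ℝ) =
    (3 * k + (3 * k / 2) ^ (2 / 5 : ℝ)) * M ^ (4 / 9 : ℝ) * n ^ (5 / 9 : ℝ) := by
  have hnear : M * (n / M) ^ (5 / 9 : ℝ) = M ^ (4 / 9 : ℝ) * n ^ (5 / 9 : ℝ) := by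
    rw [Real.div_rpow hn.le hM.le, mul_div_assoc', div_eq_iff (by positivity), mul_right_comm,
      ← Real.rpow_add hM]
    norm_num
  have hfar : n * (n / M) ^ (-4 / 9 : ℝ) = M ^ (4 / 9 : ℝ) * n ^ (5 / 9 : ℝ) := by
    rw [neg_div, Real.rpow_neg (by positivity), ← Real.inv_rpow (by positivity), inv_div,
      Real.div_rpow hM.le hn.le, mul_div_assoc', div_eq_iff (by positivity), mul_assoc,
      ← Real.rpow_add hn]
    norm_num
    ring
  have hsplit : (3 * k * (((n / M) ^ (5 / 9 : ℝ)) ^ (-2 : ℝ) / 2)) ^ (2 / 5 : ℝ) =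
      (3 * k / 2) ^ (2 / 5 : ℝ) * (n / M) ^ (-4 / 9 : ℝ) := by
    rw [mul_div_assoc', mul_div_right_comm, Real.mul_rpow (by positivity) (by positivity),
      ← Real.rpow_mul (by positivity), ← Real.rpow_mul (by positivity)]
    norm_num
  rw [hsplit]
  linear_combination (3 * k) * hnear + (3 * k / 2) ^ (2 / 5 : ℝ) * hfar

/-- Interpolation bound for the Coulomb potential of a density in `L^∞ ∩ L^{5/3}`. -/
theorem lintegral_div_sq_le_interpolation {h : EuclideanSpace ℝ (Fin 3) → ENNReal}
    (hh : AEMeasurable h) {M : ℝ} (hM : 0 < M) (hbound : ∀ᵐ y, h y ≤ ENNReal.ofReal M)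
    (x : EuclideanSpace ℝ (Fin 3)) {k : ℝ}
    (hk : k = volume.real (Metric.ball (0 : EuclideanSpace ℝ (Fin 3)) 1)) (hkpos : 0 < k) :
    ∫⁻ y, h y / (‖x - y‖₊ : ENNReal) ^ 2 ≤
      ENNReal.ofReal ((3 * k + (3 * k / 2) ^ (2 / 5 : ℝ)) * M ^ (4 / 9 : ℝ)) *
        ((∫⁻ y, h y ^ (5 / 3 : ℝ)) ^ (3 / 5 : ℝ)) ^ (5 / 9 : ℝ) := by
  rcases eq_or_ne (∫⁻ y, h y ^ (5 / 3 : ℝ)) 0 with hzero | hzero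
  · rw [lintegral_eq_zero_iff' (hh.pow_const _)] at hzero
    refine le_of_eq_of_le ?_ zero_le
    rw [← lintegral_zero (μ := (volume : Measure (EuclideanSpace ℝ (Fin 3))))]
    refine lintegral_congr_ae ?_
    filter_upwards [hzero] with y hy
    have : h y = 0 := (ENNReal.rpow_eq_zero_iff_of_pos (by norm_num)).1 hy
    simp [this]
  have hsplit := fun r hr => lintegral_div_sq_le_of_radius hh hbound x (r := r) hr
  rw [← hk] at hsplit
  set N := (∫⁻ y, h y ^ (5 / 3 : ℝ)) ^ (3 / 5 : ℝ) with hN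
  have hN0 : N ≠ 0 := by
    rwa [hN, ne_eq, ENNReal.rpow_eq_zero_iff_of_pos (by norm_num)]
  rcases eq_or_ne N ⊤ with htop | htop
  · rw [htop, ENNReal.top_rpow_of_pos (by norm_num), ENNReal.mul_top]
    · exact le_top
    · simp only [ne_eq, ENNReal.ofReal_eq_zero, not_le]
      positivity
  have hn : 0 < N.toReal := ENNReal.toReal_pos hN0 htop
  have hNreal : N = ENNReal.ofReal N.toReal := (ENNReal.ofReal_toReal htop).symm
  refine (hsplit ((N.toReal / M) ^ (5 / 9 : ℝ)) (by positivity)).trans_eq ?_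
  generalize N.toReal = n at hn hNreal
  rw [hNreal, ENNReal.ofReal_rpow_of_nonneg (by positivity) (by norm_num),
    ENNReal.ofReal_rpow_of_nonneg (by positivity) (by norm_num),
    ← ENNReal.ofReal_mul (by positivity), ← ENNReal.ofReal_mul (by positivity),
    ← ENNReal.ofReal_mul (by positivity), ← ENNReal.ofReal_add (by positivity) (by positivity),
    near_far_bound_at_balanced_radius hkpos.le hM hn]

/-- **Basic electric-field estimate.**
There is an absolute constant `C > 0` such that: for all `A, R > 0`, every `v₀ ∈ ℝ³`, every
measurable `f : ℝ³ × ℝ³ → ℝ` with `0 ≤ f ≤ A` a.e., and `ρ(x) = ∫_{‖v − v₀‖ < R} f(x,v) dv`,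
one has, for every `x ∈ ℝ³` (in the extended reals),
`∫ ρ(y)‖x − y‖^{−2} dy ≤ C·A^{4/9}·‖ρ‖_{L^{5/3}}^{5/9}·R^{4/3}`. -/
theorem stmt11 :
    ∃ C > 0, ∀ A R : ℝ, 0 < A → 0 < R →
      ∀ v₀ : EuclideanSpace ℝ (Fin 3),
      ∀ f : EuclideanSpace ℝ (Fin 3) → EuclideanSpace ℝ (Fin 3) → ℝ,
        Measurable (fun p : EuclideanSpace ℝ (Fin 3) × EuclideanSpace ℝ (Fin 3) =>
          f p.1 p.2) →
        (∀ᵐ p : EuclideanSpace ℝ (Fin 3) × EuclideanSpace ℝ (Fin 3) ∂volume,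
          0 ≤ f p.1 p.2 ∧ f p.1 p.2 ≤ A) →
        ∀ ρ : EuclideanSpace ℝ (Fin 3) → ℝ,
          (∀ x, ρ x = ∫ v in Metric.ball v₀ R, f x v) →
          ∀ x : EuclideanSpace ℝ (Fin 3),
            ∫⁻ y, ENNReal.ofReal (ρ y) / (‖x - y‖₊ : ENNReal) ^ 2 ≤
              ENNReal.ofReal (C * A ^ ((4 : ℝ) / 9) * R ^ ((4 : ℝ) / 3)) *
                eLpNorm ρ (ENNReal.ofReal (5 / 3)) volume ^ ((5 : ℝ) / 9) := by
  set k := volume.real (Metric.ball (0 : EuclideanSpace ℝ (Fin 3)) 1) with hk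
  have hkpos : 0 < k :=
    ENNReal.toReal_pos (Metric.measure_ball_pos _ _ one_pos).ne' measure_ball_lt_top.ne
  refine ⟨(3 * k + (3 * k / 2) ^ (2 / 5 : ℝ)) * k ^ (4 / 9 : ℝ), by positivity, ?_⟩
  intro A R hA hR v₀ f hf hfA ρ hρ x
  have hball : volume.real (Metric.ball v₀ R) = R ^ 3 * k := by
    rw [measureReal_def, Measure.addHaar_ball _ _ hR.le, ENNReal.toReal_mul,
      ENNReal.toReal_ofReal (by positivity), hk, measureReal_def]
    simp
  have hρmeas : Measurable ρ := by
    rw [funext hρ]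
    exact (StronglyMeasurable.integral_prod_right (f := fun y v => f y v)
      hf.stronglyMeasurable).measurable
  have hρnonneg_le : ∀ᵐ y, 0 ≤ ρ y ∧ ρ y ≤ A * (R ^ 3 * k) := by
    filter_upwards [Measure.ae_ae_of_ae_prod hfA] with y hy
    rw [hρ, ← hball]
    refine ⟨integral_nonneg_of_ae (ae_restrict_of_ae (hy.mono fun v hv => hv.1)),
      (le_abs_self _).trans ?_⟩
    exact norm_setIntegral_le_of_norm_le_const_ae (f := f y) measure_ball_lt_top
      (ae_restrict_of_ae (hy.mono fun v hv => (Real.norm_of_nonneg hv.1).trans_le hv.2))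
  have hnorm : eLpNorm ρ (ENNReal.ofReal (5 / 3)) volume =
      (∫⁻ y, ENNReal.ofReal (ρ y) ^ (5 / 3 : ℝ)) ^ (3 / 5 : ℝ) := by
    rw [eLpNorm_eq_lintegral_rpow_enorm_toReal (by norm_num) ENNReal.ofReal_ne_top,
      ENNReal.toReal_ofReal (by norm_num)]
    norm_num only
    congr 1
    refine lintegral_congr_ae ?_
    filter_upwards [hρnonneg_le] with y hy
    rw [Real.enorm_of_nonneg hy.1]
  rw [hnorm]
  refine (lintegral_div_sq_le_interpolation hρmeas.ennreal_ofReal.aemeasurable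
    (M := A * (R ^ 3 * k)) (by positivity)
    (hρnonneg_le.mono fun y hy => ENNReal.ofReal_le_ofReal hy.2) x hk hkpos).trans_eq ?_
  congr 2
  rw [Real.mul_rpow hA.le (by positivity), Real.mul_rpow (by positivity) hkpos.le,
    ← Real.rpow_natCast R 3, ← Real.rpow_mul hR.le]
  norm_num
  ring
end

section
/- Let 0 ≤ k ≤ l be real numbers. There exists a constant C > 0, depending only on k and l, such that for every A > 0, every measurable f : ℝ³ × ℝ³ → ℝ with 0 ≤ f(x,v) ≤ A for almost every (x,v), and every measurable h : ℝ³ × ℝ³ → ℝ with h(x,v) ≥ 1 + ‖v‖²/2 for all (x,v), one has ( ∫_{ℝ³} ( ∫_{ℝ³} h(x,v)^{k/2}·f(x,v) dv )^{(l+3)/(k+3)} dx )^{(k+3)/(l+3)} ≤ C · A^{(l−k)/(l+3)} · ( ∫_{ℝ³} ∫_{ℝ³} h(x,v)^{l/2}·f(x,v) dv dx )^{(k+3)/(l+3)}. -/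
open MeasureTheory

/-- Splitting a moment at the energy level `R ^ 2`: below it the velocities stay in a ball of
radius `2 * R`, above it the higher moment dominates. -/
lemma energy_rpow_mul_le_indicator_add {k l A R η φ : ℝ} (hk : 0 ≤ k) (hkl : k ≤ l) (hR : 0 < R)
    (v : EuclideanSpace ℝ (Fin 3)) (hη : 1 + ‖v‖ ^ 2 / 2 ≤ η) (hφ : 0 ≤ φ) (hφA : φ ≤ A) :
    ENNReal.ofReal η ^ (k / 2) * ENNReal.ofReal φ ≤
      (Metric.ball (0 : EuclideanSpace ℝ (Fin 3)) (2 * R)).indicator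
          (fun _ => ENNReal.ofReal (R ^ k * A)) v +
        ENNReal.ofReal (R ^ (k - l)) * (ENNReal.ofReal η ^ (l / 2) * ENNReal.ofReal φ) := by
  have hη0 : 0 < η := by nlinarith [sq_nonneg ‖v‖]
  rw [ENNReal.ofReal_rpow_of_pos hη0, ENNReal.ofReal_rpow_of_pos hη0]
  rcases lt_or_ge η (R ^ 2) with hlt | hge
  · have hv : v ∈ Metric.ball (0 : EuclideanSpace ℝ (Fin 3)) (2 * R) := by
      rw [mem_ball_zero_iff]
      nlinarith [norm_nonneg v]
    rw [Set.indicator_of_mem hv, ← ENNReal.ofReal_mul (by positivity)]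
    refine le_add_right (ENNReal.ofReal_le_ofReal ?_)
    have hpow : η ^ (k / 2) ≤ R ^ k := by
      calc η ^ (k / 2) ≤ (R ^ 2) ^ (k / 2) := by gcongr
        _ = R ^ k := by
          rw [← Real.rpow_natCast, ← Real.rpow_mul hR.le]
          congr 1
          push_cast
          ring
    exact mul_le_mul hpow hφA hφ (by positivity)
  · refine le_add_left ?_
    rw [← mul_assoc, ← ENNReal.ofReal_mul (p := R ^ (k - l)) (by positivity)]
    gcongr
    have hpow : η ^ ((k - l) / 2) ≤ R ^ (k - l) := by
      calc η ^ ((k - l) / 2) ≤ (R ^ 2) ^ ((k - l) / 2) :=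
            Real.rpow_le_rpow_of_nonpos (by positivity) hge (by linarith)
        _ = R ^ (k - l) := by
          rw [← Real.rpow_natCast, ← Real.rpow_mul hR.le]
          congr 1
          push_cast
          ring
    calc η ^ (k / 2) = η ^ ((k - l) / 2) * η ^ (l / 2) := by
          rw [← Real.rpow_add hη0]
          congr 1
          ring
      _ ≤ R ^ (k - l) * η ^ (l / 2) := by gcongr

/-- The bound on the moment of order `k` by that of order `l`, with a free truncation radius. -/
lemma lintegral_energy_rpow_le_add {k l A R : ℝ} (hk : 0 ≤ k) (hkl : k ≤ l) (hA : 0 < A)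
    (hR : 0 < R) {φ η : EuclideanSpace ℝ (Fin 3) → ℝ}
    (hφ : ∀ᵐ v, 0 ≤ φ v ∧ φ v ≤ A) (hη : ∀ v, 1 + ‖v‖ ^ 2 / 2 ≤ η v) :
    ∫⁻ v, ENNReal.ofReal (η v) ^ (k / 2) * ENNReal.ofReal (φ v) ≤
      ENNReal.ofReal (8 * volume.real (Metric.ball (0 : EuclideanSpace ℝ (Fin 3)) 1) *
          (R ^ (k + 3) * A)) +
        ENNReal.ofReal (R ^ (k - l)) *
          ∫⁻ v, ENNReal.ofReal (η v) ^ (l / 2) * ENNReal.ofReal (φ v) := by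
  have hball : ENNReal.ofReal (R ^ k * A) *
      volume (Metric.ball (0 : EuclideanSpace ℝ (Fin 3)) (2 * R)) =
      ENNReal.ofReal (8 * volume.real (Metric.ball (0 : EuclideanSpace ℝ (Fin 3)) 1) *
        (R ^ (k + 3) * A)) := by
    rw [Measure.addHaar_ball_of_pos _ _ (by positivity), finrank_euclideanSpace_fin,
      ← ENNReal.ofReal_toReal (measure_ball_lt_top (μ := volume)
        (x := (0 : EuclideanSpace ℝ (Fin 3))) (r := 1)).ne,
      ← ENNReal.ofReal_mul (by positivity), ← ENNReal.ofReal_mul (by positivity),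
      Real.rpow_add hR, show R ^ (3 : ℝ) = R ^ 3 by exact_mod_cast Real.rpow_natCast R 3,
      measureReal_def]
    congr 1
    ring
  calc ∫⁻ v, ENNReal.ofReal (η v) ^ (k / 2) * ENNReal.ofReal (φ v)
      ≤ ∫⁻ v, ((Metric.ball (0 : EuclideanSpace ℝ (Fin 3)) (2 * R)).indicator
          (fun _ => ENNReal.ofReal (R ^ k * A)) v +
        ENNReal.ofReal (R ^ (k - l)) *
          (ENNReal.ofReal (η v) ^ (l / 2) * ENNReal.ofReal (φ v))) :=
        lintegral_mono_ae (hφ.mono fun v hv =>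
          energy_rpow_mul_le_indicator_add hk hkl hR v (hη v) hv.1 hv.2)
    _ = _ := by
      rw [lintegral_add_left (measurable_const.indicator measurableSet_ball),
        lintegral_const_mul' _ _ ENNReal.ofReal_ne_top,
        lintegral_indicator_const measurableSet_ball, hball]

/-- The interpolation inequality for a single velocity profile. -/
lemma lintegral_energy_rpow_le {k l A : ℝ} (hk : 0 ≤ k) (hkl : k ≤ l) (hA : 0 < A)
    {φ η : EuclideanSpace ℝ (Fin 3) → ℝ}
    (hφ : ∀ᵐ v, 0 ≤ φ v ∧ φ v ≤ A) (hη : ∀ v, 1 + ‖v‖ ^ 2 / 2 ≤ η v) :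
    ∫⁻ v, ENNReal.ofReal (η v) ^ (k / 2) * ENNReal.ofReal (φ v) ≤
      ENNReal.ofReal ((8 * volume.real (Metric.ball (0 : EuclideanSpace ℝ (Fin 3)) 1) + 1) *
          A ^ ((l - k) / (l + 3))) *
        (∫⁻ v, ENNReal.ofReal (η v) ^ (l / 2) * ENNReal.ofReal (φ v)) ^
          ((k + 3) / (l + 3)) := by
  have hl3 : 0 < l + 3 := by linarith
  have hexp : 0 < (k + 3) / (l + 3) := div_pos (by linarith) hl3
  have hsplit := fun {R : ℝ} (hR : 0 < R) =>
    lintegral_energy_rpow_le_add hk hkl hA hR hφ hη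
  have hmono : ∫⁻ v, ENNReal.ofReal (η v) ^ (k / 2) * ENNReal.ofReal (φ v) ≤
      ∫⁻ v, ENNReal.ofReal (η v) ^ (l / 2) * ENNReal.ofReal (φ v) := by
    refine lintegral_mono fun v => ?_
    have h1 : 1 ≤ ENNReal.ofReal (η v) := by
      rw [ENNReal.one_le_ofReal]
      nlinarith [hη v, sq_nonneg ‖v‖]
    gcongr
  generalize ∫⁻ v, ENNReal.ofReal (η v) ^ (l / 2) * ENNReal.ofReal (φ v) = M at hsplit hmono ⊢
  have hc : 0 ≤ volume.real (Metric.ball (0 : EuclideanSpace ℝ (Fin 3)) 1) := measureReal_nonneg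
  generalize volume.real (Metric.ball (0 : EuclideanSpace ℝ (Fin 3)) 1) = c at hsplit hc ⊢
  rcases eq_or_ne M 0 with rfl | hM0
  · exact hmono.trans zero_le
  rcases eq_or_ne M ⊤ with rfl | hMtop
  · rw [ENNReal.top_rpow_of_pos hexp, ENNReal.mul_top]
    · exact le_top
    · rw [Ne, ENNReal.ofReal_eq_zero, not_le]
      positivity
  obtain ⟨m, hm, rfl⟩ : ∃ m : ℝ, 0 < m ∧ M = ENNReal.ofReal m :=
    ⟨M.toReal, ENNReal.toReal_pos hM0 hMtop, (ENNReal.ofReal_toReal hMtop).symm⟩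
  -- The radius balancing the two contributions.
  obtain ⟨R, hR, hRm⟩ : ∃ R : ℝ, 0 < R ∧ R ^ (l + 3) * A = m :=
    ⟨(m / A) ^ (l + 3)⁻¹, by positivity, by
      rw [Real.rpow_inv_rpow (by positivity) hl3.ne', div_mul_cancel₀ _ hA.ne']⟩
  have hlow : A ^ ((l - k) / (l + 3)) * m ^ ((k + 3) / (l + 3)) = R ^ (k + 3) * A := by
    rw [← hRm, Real.mul_rpow (by positivity) hA.le, ← Real.rpow_mul hR.le,
      mul_div_cancel₀ _ hl3.ne', mul_left_comm, ← Real.rpow_add hA, ← add_div,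
      show l - k + (k + 3) = l + 3 by ring, div_self hl3.ne', Real.rpow_one]
  have hhigh : R ^ (k - l) * m = R ^ (k + 3) * A := by
    rw [← hRm, ← mul_assoc, ← Real.rpow_add hR]
    congr 2
    ring
  refine (hsplit hR).trans_eq ?_
  rw [← ENNReal.ofReal_mul (by positivity), ENNReal.ofReal_rpow_of_pos hm,
    ← ENNReal.ofReal_mul (by positivity), ← ENNReal.ofReal_add (by positivity) (by positivity),
    mul_assoc (8 * c + 1), hlow, hhigh]
  congr 1
  ring

/-- **Kinetic interpolation inequality.**
For real `0 ≤ k ≤ l` there is `C > 0`, depending only on `k, l`, such that for every `A > 0`,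
every measurable `f : ℝ³ × ℝ³ → ℝ` with `0 ≤ f ≤ A` a.e., and every measurable pointwise
energy `h` with `h(x,v) ≥ 1 + ‖v‖²/2`, one has (in the extended reals)
`‖∫ h^{k/2} f dv‖_{L^{(l+3)/(k+3)}_x} ≤ C·A^{(l−k)/(l+3)}·(∫∫ h^{l/2} f dv dx)^{(k+3)/(l+3)}`. -/
theorem stmt12 (k l : ℝ) (hk : 0 ≤ k) (hkl : k ≤ l) :
    ∃ C > 0, ∀ A : ℝ, 0 < A →
      ∀ f h : EuclideanSpace ℝ (Fin 3) → EuclideanSpace ℝ (Fin 3) → ℝ,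
        Measurable (fun p : EuclideanSpace ℝ (Fin 3) × EuclideanSpace ℝ (Fin 3) =>
          f p.1 p.2) →
        Measurable (fun p : EuclideanSpace ℝ (Fin 3) × EuclideanSpace ℝ (Fin 3) =>
          h p.1 p.2) →
        (∀ᵐ p : EuclideanSpace ℝ (Fin 3) × EuclideanSpace ℝ (Fin 3) ∂volume,
          0 ≤ f p.1 p.2 ∧ f p.1 p.2 ≤ A) →
        (∀ x v, 1 + ‖v‖ ^ 2 / 2 ≤ h x v) →
        (∫⁻ x, (∫⁻ v, ENNReal.ofReal (h x v) ^ (k / 2) * ENNReal.ofReal (f x v)) ^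
            ((l + 3) / (k + 3))) ^ ((k + 3) / (l + 3)) ≤
          ENNReal.ofReal (C * A ^ ((l - k) / (l + 3))) *
            (∫⁻ x, ∫⁻ v, ENNReal.ofReal (h x v) ^ (l / 2) * ENNReal.ofReal (f x v)) ^
              ((k + 3) / (l + 3)) := by
  refine ⟨8 * volume.real (Metric.ball (0 : EuclideanSpace ℝ (Fin 3)) 1) + 1, by positivity, ?_⟩
  intro A hA f h _ _ hf hh
  have hp : 0 < (l + 3) / (k + 3) := div_pos (by linarith) (by linarith)
  have hinv : (k + 3) / (l + 3) = ((l + 3) / (k + 3))⁻¹ := (inv_div _ _).symm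
  rw [hinv, ENNReal.rpow_inv_le_iff hp, ENNReal.mul_rpow_of_nonneg _ _ hp.le,
    ENNReal.rpow_inv_rpow hp.ne',
    ← lintegral_const_mul' _ _ (ENNReal.rpow_ne_top_of_nonneg hp.le ENNReal.ofReal_ne_top)]
  refine lintegral_mono_ae ?_
  filter_upwards [Measure.ae_ae_of_ae_prod hf] with x hx
  have hslice := lintegral_energy_rpow_le hk hkl hA hx (hh x)
  rwa [hinv, ← ENNReal.rpow_le_rpow_iff hp, ENNReal.mul_rpow_of_nonneg _ _ hp.le,
    ENNReal.rpow_inv_rpow hp.ne'] at hslice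
end

section
/- Let a ≤ b be real numbers, let d ≥ 1, and let D : [a,b] → ℝ^d be differentiable. Let s̄ ∈ [a,b] be a point at which s ↦ ‖D(s)‖ attains its minimum over [a,b], and let ε ≥ 0 be such that ‖D(s) − D(s̄) − (s − s̄)·D'(s̄)‖ ≤ ε·|s − s̄| for all s ∈ [a,b]. Then ‖D(s)‖ ≥ (‖D'(s̄)‖ − ε)·|s − s̄| for all s ∈ [a,b]. -/
/-- First-order optimality for the norm: moving from a minimizer `x` of `‖f‖` over a convex set
towards another point `y` of the set does not decrease `‖f‖` to first order. -/
theorem mul_inner_nonneg_of_isMinOn_norm {E : Type*} [NormedAddCommGroup E]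
    [InnerProductSpace ℝ E] {f : ℝ → E} {f' : E} {S : Set ℝ} {x y : ℝ} (hS : Convex ℝ S)
    (hx : x ∈ S) (hy : y ∈ S) (hf : HasDerivWithinAt f f' S x)
    (hmin : IsMinOn (fun t => ‖f t‖) S x) :
    0 ≤ (y - x) * inner ℝ (f x) f' := by
  have hmin_sq : IsMinOn (fun t => ‖f t‖ ^ 2) S x := fun t ht =>
    pow_le_pow_left₀ (norm_nonneg _) (hmin ht) 2
  have h := hmin_sq.localize.hasFDerivWithinAt_nonneg hf.norm_sq.hasFDerivWithinAt
    (sub_mem_posTangentConeAt_of_segment_subset (hS.segment_subset hx hy))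
  simp only [ContinuousLinearMap.toSpanSingleton_apply, smul_eq_mul] at h
  linarith

/-- If `⟪u, v⟫ ≥ 0` then adding `u` to `v` does not shorten `v`. -/
theorem norm_le_norm_add_of_inner_nonneg {E : Type*} [NormedAddCommGroup E]
    [InnerProductSpace ℝ E] {u v : E} (h : 0 ≤ inner ℝ u v) : ‖v‖ ≤ ‖u + v‖ := by
  refine (sq_le_sq₀ (norm_nonneg _) (norm_nonneg _)).mp ?_
  rw [norm_add_sq_real]
  nlinarith [sq_nonneg ‖u‖]

/-- **Separation estimate at a minimal point.**
Let `D : [a,b] → ℝ^d` be differentiable with derivative `D'`, let `s̄ ∈ [a,b]` minimize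
`‖D‖` over `[a,b]`, and suppose the Taylor bound
`‖D(s) − D(s̄) − (s − s̄)·D'(s̄)‖ ≤ ε·|s − s̄|` holds on `[a,b]`. Then
`‖D(s)‖ ≥ (‖D'(s̄)‖ − ε)·|s − s̄|` for all `s ∈ [a,b]`. -/
theorem stmt15 (a b : ℝ) (hab : a ≤ b) (d : ℕ) (hd : 1 ≤ d)
    (D D' : ℝ → EuclideanSpace ℝ (Fin d))
    (hD : ∀ s ∈ Set.Icc a b, HasDerivWithinAt D (D' s) (Set.Icc a b) s)
    (sbar : ℝ) (hsbar : sbar ∈ Set.Icc a b)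
    (hmin : ∀ s ∈ Set.Icc a b, ‖D sbar‖ ≤ ‖D s‖)
    (ε : ℝ) (hε : 0 ≤ ε)
    (htaylor : ∀ s ∈ Set.Icc a b,
      ‖D s - D sbar - (s - sbar) • D' sbar‖ ≤ ε * |s - sbar|) :
    ∀ s ∈ Set.Icc a b, (‖D' sbar‖ - ε) * |s - sbar| ≤ ‖D s‖ := by
  intro s hs
  have hinner : 0 ≤ inner ℝ (D sbar) ((s - sbar) • D' sbar) := by
    rw [real_inner_smul_right]
    exact mul_inner_nonneg_of_isMinOn_norm (convex_Icc a b) hsbar hs (hD sbar hsbar) hmin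
  have hlinear := norm_le_norm_add_of_inner_nonneg hinner
  rw [norm_smul, Real.norm_eq_abs] at hlinear
  have htriangle := norm_sub_norm_le (D sbar + (s - sbar) • D' sbar) (D s)
  rw [norm_sub_rev, ← sub_sub] at htriangle
  linarith [htaylor s hs]
end
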